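/- arXiv:1703.06262 — 2 statements merged into one kernel-verified Lean document; each statement's English description precedes it below -/
import Mathlib

section
/- (Homogeneity of blowups and shrink-downs.) Let ψ(x) = (a/2)(x₁⁺)², a > 1, and let u ∈ P_∞(M) satisfy Δu = χ_{{0<u<ψ}} + Δψ·χ_{{0<u=ψ}} almost everywhere in ℝⁿ. Then every blowup u₀ of u at 0 and every shrink-down u_∞ of u at 0 is homogeneous of degree two: u₀(λx) = λ²u₀(x) and u_∞(λx) = λ²u_∞(x) for all x ∈ ℝⁿ and λ > 0. -/
/- Setting: the double obstacle problem
   Δu = f·χ_{Ω(u)∩{u<ψ}} + Δψ·χ_{Ω(u)∩{u=ψ}},  u ≤ ψ,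
   following "Regularity of the free boundary for the double obstacle problem". -/

open Set Metric MeasureTheory Filter
open scoped RealInnerProductSpace NNReal

noncomputable section

/-- Euclidean space `ℝⁿ`. -/
abbrev E (n : ℕ) := EuclideanSpace ℝ (Fin n)

variable {n : ℕ}

/-- Pointwise Laplacian, via iterated `fderiv` along the coordinate directions
(defined a.e. for `C^{1,1}` functions, junk value elsewhere). -/
def lap (u : E n → ℝ) (x : E n) : ℝ :=
  ∑ i : Fin n, fderiv ℝ (fun y => fderiv ℝ u y (EuclideanSpace.single i 1)) x
    (EuclideanSpace.single i 1)

/-- `Λ(v) = {x ∈ D : v(x) = 0, ∇v(x) = 0}`. -/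
def Lam (D : Set (E n)) (v : E n → ℝ) : Set (E n) :=
  {x ∈ D | v x = 0 ∧ gradient v x = 0}

/-- `Ω(v) = D \ Λ(v)`. -/
def Om (D : Set (E n)) (v : E n → ℝ) : Set (E n) := D \ Lam D v

/-- `Γ(v) = ∂Λ(v) ∩ D`. -/
def Gam (D : Set (E n)) (v : E n → ℝ) : Set (E n) := frontier (Lam D v) ∩ D

/-- `Λ^ψ(u) = {x ∈ D : u(x) = ψ(x)}`. -/
def LamPsi (D : Set (E n)) (u ψ : E n → ℝ) : Set (E n) := {x ∈ D | u x = ψ x}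

/-- `Γ^ψ(u) = ∂Λ^ψ(u) ∩ D`. -/
def GamPsi (D : Set (E n)) (u ψ : E n → ℝ) : Set (E n) := frontier (LamPsi D u ψ) ∩ D

/-- The unit ball `B₁`. -/
def B1 (n : ℕ) : Set (E n) := ball 0 1

/-- The class `P₁(M)`: `f ∈ C^{0,1}(B₁)`, `ψ ∈ C^{1,1}(B₁) ∩ C^{2,1}(closure Ω(ψ))`,
`u ∈ C^{1,1}(B₁)` with `‖D²u‖_{L^∞(B₁)} ≤ M`, `u ≤ ψ` in `B₁`,
`Δu = f·χ_{Ω(u)∩{u<ψ}} + Δψ·χ_{Ω(u)∩{u=ψ}}` a.e. in `B₁`, and `0 ∈ Γ^d(u)`. -/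
structure P1 (n : ℕ) (M : ℝ) (u ψ f : E n → ℝ) : Prop where
  f_lip : ∃ K : ℝ≥0, LipschitzOnWith K f (B1 n)
  psi_c1 : ContDiffOn ℝ 1 ψ (B1 n)
  psi_c11 : ∃ K : ℝ≥0, LipschitzOnWith K (fderiv ℝ ψ) (B1 n)
  psi_c2 : ContDiffOn ℝ 2 ψ (Om (B1 n) ψ)
  psi_c21 : ∃ K : ℝ≥0, LipschitzOnWith K (fderiv ℝ (fderiv ℝ ψ)) (closure (Om (B1 n) ψ))
  u_c1 : ContDiffOn ℝ 1 u (B1 n)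
  u_c11 : LipschitzOnWith (Real.toNNReal M) (fderiv ℝ u) (B1 n)
  u_le : ∀ x ∈ B1 n, u x ≤ ψ x
  u_eq : ∀ᵐ x : E n, x ∈ B1 n →
    lap u x = (Om (B1 n) u ∩ {y | u y < ψ y}).indicator f x
      + (Om (B1 n) u ∩ {y | u y = ψ y}).indicator (lap ψ) x
  zero_mem : (0 : E n) ∈ Gam (B1 n) u ∩ GamPsi (B1 n) u ψ

/-- Minimal diameter: least distance between two parallel hyperplanes whose
enclosed slab contains `A`. -/
def MD (A : Set (E n)) : ℝ :=
  sInf {d : ℝ | 0 ≤ d ∧ ∃ (e : E n) (b : ℝ), ‖e‖ = 1 ∧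
    ∀ x ∈ A, b ≤ ⟪x, e⟫ ∧ ⟪x, e⟫ ≤ b + d}

/-- Thickness `δ_r(v) = MD(Λ(v) ∩ B_r)/r` (centered at the origin). -/
def thick (D : Set (E n)) (v : E n → ℝ) (r : ℝ) : ℝ := MD (Lam D v ∩ ball (0 : E n) r) / r

/-- The class `P_∞(M)` (with constant `a > 1`):
`Δu = χ_{Ω(u)∩{u<ψ}} + a·χ_{Ω(u)∩{u=ψ}}`, `u ≤ ψ`, `Δψ = a·χ_{Ω(ψ)}` a.e. in `ℝⁿ`,
`u, ψ ∈ C^{1,1}(ℝⁿ)` with `‖D²u‖_{L^∞} ≤ M`, and `0 ∈ Γ(u)`. -/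
structure Pinf (n : ℕ) (M a : ℝ) (u ψ : E n → ℝ) : Prop where
  ha : 1 < a
  u_c1 : ContDiff ℝ 1 u
  u_c11 : LipschitzWith (Real.toNNReal M) (fderiv ℝ u)
  psi_c1 : ContDiff ℝ 1 ψ
  psi_c11 : ∃ K : ℝ≥0, LipschitzWith K (fderiv ℝ ψ)
  u_le : ∀ x, u x ≤ ψ x
  u_eq : ∀ᵐ x : E n, lap u x =
    (Om univ u ∩ {y | u y < ψ y}).indicator (fun _ => (1 : ℝ)) x
      + (Om univ u ∩ {y | u y = ψ y}).indicator (fun _ => a) x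
  psi_eq : ∀ᵐ x : E n, lap ψ x = (Om univ ψ).indicator (fun _ => a) x
  zero_mem : (0 : E n) ∈ frontier (Lam univ u)

/-- The rescaling `u_{λ,x₀}(x) = (u(x₀ + λx) − u(x₀))/λ²`. -/
def rescale (u : E n → ℝ) (x₀ : E n) (l : ℝ) : E n → ℝ :=
  fun x => (u (x₀ + l • x) - u x₀) / l ^ 2

/-- `v` and `w` are `ε`-close in `C^{1,α}(closedBall 0 R)`. -/
def CloseC1a (v w : E n → ℝ) (α R ε : ℝ) : Prop :=
  ∀ x ∈ closedBall (0 : E n) R,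
    |v x - w x| ≤ ε ∧ ‖fderiv ℝ v x - fderiv ℝ w x‖ ≤ ε ∧
      ∀ y ∈ closedBall (0 : E n) R,
        ‖fderiv ℝ v x - fderiv ℝ w x - (fderiv ℝ v y - fderiv ℝ w y)‖ ≤ ε * ‖x - y‖ ^ α

/-- `u₀` is a blowup of `u` at `x₀`: a `C^{1,α}_loc`-limit (for every `0 < α < 1`) of
rescalings along some sequence `λ_j → 0`, `λ_j > 0`. -/
def IsBlowupAt (u : E n → ℝ) (x₀ : E n) (u₀ : E n → ℝ) : Prop :=
  ∃ l : ℕ → ℝ, (∀ j, 0 < l j) ∧ Tendsto l atTop (nhds 0) ∧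
    ∀ α : ℝ, 0 < α → α < 1 → ∀ R : ℝ, 0 < R → ∀ ε : ℝ, 0 < ε → ∃ N, ∀ j ≥ N,
      CloseC1a (rescale u x₀ (l j)) u₀ α R ε

/-- `u₀` is a shrink-down of `u` at `x₀`: same, along some sequence `λ_j → ∞`. -/
def IsShrinkdownAt (u : E n → ℝ) (x₀ : E n) (u₀ : E n → ℝ) : Prop :=
  ∃ l : ℕ → ℝ, (∀ j, 0 < l j) ∧ Tendsto l atTop atTop ∧
    ∀ α : ℝ, 0 < α → α < 1 → ∀ R : ℝ, 0 < R → ∀ ε : ℝ, 0 < ε → ∃ N, ∀ j ≥ N,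
      CloseC1a (rescale u x₀ (l j)) u₀ α R ε


/-! ### The cut-off -/

/-- Truncated quadratic weight. -/
def mm (R : ℝ) (x : E n) : ℝ := max (R ^ 2 - ‖x‖ ^ 2) 0

/-- Deviation from 2-homogeneity. -/
def GG (w : E n → ℝ) (x : E n) : ℝ := fderiv ℝ w x x - 2 * w x

/-- A Weiss type energy. -/
def WW (R : ℝ) (w : E n → ℝ) : ℝ :=
  ∫ x, (mm R x ^ 2 * (∑ i, (fderiv ℝ w x (EuclideanSpace.single i 1)) ^ 2 + 2 * w x)
    - 8 * mm R x * w x ^ 2)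

lemma mm_nonneg (R : ℝ) (x : E n) : 0 ≤ mm R x := le_max_right _ _

lemma mm_le (R : ℝ) (x : E n) : mm R x ≤ R ^ 2 := by
  unfold mm; apply max_le <;> nlinarith [sq_nonneg ‖x‖, sq_nonneg R]

lemma mm_cont (R : ℝ) : Continuous (mm R : E n → ℝ) := by
  unfold mm; fun_prop

lemma mm_zero {R : ℝ} (hR : 0 ≤ R) {x : E n} (hx : R < ‖x‖) : mm R x = 0 := by
  unfold mm; apply max_eq_right; nlinarith

lemma mm_supp {R : ℝ} (hR : 0 ≤ R) : HasCompactSupport (mm R : E n → ℝ) := by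
  refine HasCompactSupport.intro (isCompact_closedBall (0 : E n) R) ?_
  intro x hx
  apply mm_zero hR
  simpa using hx

lemma hasDerivAt_maxsq (t : ℝ) : HasDerivAt (fun t : ℝ => max t 0 ^ 2) (2 * max t 0) t := by
  rcases lt_trichotomy t 0 with h | h | h
  · rw [max_eq_right h.le, mul_zero]
    refine (hasDerivAt_const t (0 : ℝ)).congr_of_eventuallyEq ?_
    filter_upwards [Iio_mem_nhds h] with s hs
    rw [max_eq_right (le_of_lt hs)]; simp
  · subst h
    rw [max_self, mul_zero]
    rw [hasDerivAt_iff_isLittleO_nhds_zero]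
    simp only [zero_add, max_self, smul_zero, sub_zero]
    have h1 : (fun h : ℝ => max h 0 ^ 2 - 0 ^ 2) =O[nhds 0] (fun h : ℝ => h ^ 2) := by
      refine Asymptotics.IsBigO.of_bound 1 (Eventually.of_forall fun h => ?_)
      rw [Real.norm_eq_abs, Real.norm_eq_abs, abs_of_nonneg (by positivity : (0:ℝ) ≤ h ^ 2)]
      rcases le_total h 0 with hh | hh
      · rw [max_eq_right hh]; simp; positivity
      · rw [max_eq_left hh]; simp
    refine h1.trans_isLittleO ?_
    exact Asymptotics.isLittleO_pow_id (by norm_num)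
  · rw [max_eq_left h.le]
    have := (hasDerivAt_id t).pow 2
    simp only [id] at this
    refine HasDerivAt.congr_of_eventuallyEq (f := fun s => s ^ 2) ?_ ?_
    · simpa using hasDerivAt_pow 2 t
    filter_upwards [Ioi_mem_nhds h] with s hs
    rw [max_eq_left (le_of_lt hs)]

lemma mmsq_hasFDerivAt (R : ℝ) (x : E n) :
    HasFDerivAt (fun x : E n => mm R x ^ 2) (-(4 * mm R x) • innerSL ℝ x) x := by
  have h1 : HasFDerivAt (fun x : E n => R ^ 2 - ‖x‖ ^ 2) (-(2 • innerSL ℝ x)) x :=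
    (hasStrictFDerivAt_norm_sq x).hasFDerivAt.const_sub (R ^ 2)
  have := (hasDerivAt_maxsq (R ^ 2 - ‖x‖ ^ 2)).comp_hasFDerivAt x h1
  refine this.congr_fderiv ?_
  ext y
  have h : max (R ^ 2 - ‖x‖ ^ 2) 0 = mm R x := rfl
  rw [h]
  simp only [neg_smul, smul_neg, neg_apply, smul_apply, innerSL_apply_apply, smul_eq_mul, nsmul_eq_mul, Nat.cast_ofNat]
  ring

lemma mmsq_contDiff (R : ℝ) : ContDiff ℝ 1 (fun x : E n => mm R x ^ 2) := by
  rw [contDiff_one_iff_fderiv]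
  refine ⟨fun x => (mmsq_hasFDerivAt R x).differentiableAt, ?_⟩
  have : fderiv ℝ (fun x : E n => mm R x ^ 2) = fun x => -(4 * mm R x) • innerSL ℝ x :=
    funext fun x => (mmsq_hasFDerivAt R x).fderiv
  rw [this]
  have := mm_cont (n := n) R
  have h2 : Continuous (fun x : E n => innerSL ℝ x) := (innerSL ℝ).continuous
  exact (by fun_prop : Continuous fun x : E n => -(4 * mm R x)).smul h2

/-! ### Integration by parts -/

lemma norm_single_one (i : Fin n) : ‖(EuclideanSpace.single i (1 : ℝ) : E n)‖ = 1 := by simp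

lemma lap_measurable (w : E n → ℝ) : Measurable (lap w) := by
  unfold lap
  refine Finset.measurable_sum _ fun i _ => ?_
  exact measurable_fderiv_apply_const ℝ _ _

lemma lip_part {K : ℝ≥0} {w : E n → ℝ} (hK : LipschitzWith K (fderiv ℝ w)) (i : Fin n) :
    LipschitzWith K (fun y => fderiv ℝ w y (EuclideanSpace.single i 1)) := by
  refine LipschitzWith.of_dist_le_mul fun x y => ?_
  rw [dist_eq_norm, ← sub_apply]
  refine (ContinuousLinearMap.le_opNorm _ _).trans ?_
  rw [norm_single_one, mul_one]
  rw [← dist_eq_norm]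
  exact hK.dist_le_mul x y

lemma part_int {K : ℝ≥0} {w η : E n → ℝ} (hK : LipschitzWith K (fderiv ℝ w))
    (hη : Continuous η) (hs : HasCompactSupport η) (i : Fin n) :
    Integrable (fun x => fderiv ℝ (fun y => fderiv ℝ w y (EuclideanSpace.single i 1)) x
      (EuclideanSpace.single i 1) * η x) := by
  refine (hη.integrable_of_hasCompactSupport hs).bdd_mul (c := K)
    (measurable_fderiv_apply_const ℝ _ _).aestronglyMeasurable
    (Eventually.of_forall fun x => ?_)
  refine (ContinuousLinearMap.le_opNorm _ _).trans ?_
  rw [norm_single_one, mul_one]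
  exact norm_fderiv_le_of_lipschitz ℝ (lip_part hK i)

lemma lap_int {K : ℝ≥0} {w η : E n → ℝ} (hK : LipschitzWith K (fderiv ℝ w))
    (hη : Continuous η) (hs : HasCompactSupport η) :
    Integrable (fun x => lap w x * η x) := by
  unfold lap
  simp_rw [Finset.sum_mul]
  exact integrable_finsetSum _ fun i _ => part_int hK hη hs i

lemma ibp {K : ℝ≥0} {w η : E n → ℝ} (hK : LipschitzWith K (fderiv ℝ w))
    (hη : ContDiff ℝ 1 η) (hs : HasCompactSupport η) :
    ∫ x, lap w x * η x = - ∫ x, ∑ i, fderiv ℝ η x (EuclideanSpace.single i 1)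
      * fderiv ℝ w x (EuclideanSpace.single i 1) := by
  obtain ⟨D, hD⟩ := ContDiff.lipschitzWith_of_hasCompactSupport hs hη (by simp)
  unfold lap
  simp_rw [Finset.sum_mul]
  rw [integral_finsetSum _ fun i _ => part_int hK hη.continuous hs i]
  rw [integral_finsetSum]
  swap
  · intro i _
    refine Continuous.integrable_of_hasCompactSupport ?_ ?_
    · exact ((hη.continuous_fderiv (by simp)).clm_apply continuous_const).mul
        (lip_part hK i).continuous
    · exact (hs.fderiv_apply ℝ (EuclideanSpace.single i 1)).mul_right
  rw [← Finset.sum_neg_distrib]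
  refine Finset.sum_congr rfl fun i _ => ?_
  have h1 := (lip_part hK i).integral_lineDeriv_mul_eq (μ := volume) hD hs
    (EuclideanSpace.single i (1 : ℝ))
  have h2 : ∫ x, fderiv ℝ (fun y => fderiv ℝ w y (EuclideanSpace.single i 1)) x
      (EuclideanSpace.single i 1) * η x = ∫ x, lineDeriv ℝ
      (fun y => fderiv ℝ w y (EuclideanSpace.single i 1)) x (EuclideanSpace.single i 1) * η x := by
    refine integral_congr_ae ?_
    filter_upwards [(lip_part hK i).ae_differentiableAt (μ := volume)] with x hx
    rw [hx.lineDeriv_eq_fderiv]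
  rw [h2, h1, ← integral_neg]
  refine integral_congr_ae (Eventually.of_forall fun x => ?_)
  simp only
  rw [((hη.differentiable (by simp)) x).lineDeriv_eq_fderiv]
  simp

lemma sum_coord (x : E n) : ∑ i, x i • (EuclideanSpace.single i (1 : ℝ) : E n) = x := by
  ext j
  simp [Finset.sum_apply, Pi.single_apply]

/-- Integration by parts against `m² g`. -/
lemma ibp2 {K : ℝ≥0} {w g : E n → ℝ} {R : ℝ} (hR : 0 ≤ R) (hK : LipschitzWith K (fderiv ℝ w))
    (hg : ContDiff ℝ 1 g) :
    ∫ x, lap w x * (mm R x ^ 2 * g x) = - ∫ x, (mm R x ^ 2 *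
      ∑ i, fderiv ℝ g x (EuclideanSpace.single i 1) * fderiv ℝ w x (EuclideanSpace.single i 1)
      - 4 * mm R x * g x * fderiv ℝ w x x) := by
  have hs : HasCompactSupport (fun x : E n => mm R x ^ 2 * g x) := by
    simp_rw [sq, mul_assoc]
    exact (mm_supp hR).mul_right
  rw [ibp hK ((mmsq_contDiff R).mul hg) hs]
  congr 1
  refine integral_congr_ae (Eventually.of_forall fun x => ?_)
  simp only
  have hd : fderiv ℝ (fun x : E n => mm R x ^ 2 * g x) x
      = mm R x ^ 2 • fderiv ℝ g x + g x • (-(4 * mm R x) • innerSL ℝ x) :=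
    ((mmsq_hasFDerivAt R x).mul ((hg.differentiable (by simp)) x).hasFDerivAt).fderiv
  rw [hd]
  have hx : fderiv ℝ w x x = ∑ i, x i * fderiv ℝ w x (EuclideanSpace.single i 1) := by
    conv_lhs => rw [← sum_coord x]
    rw [map_sum]; simp [sum_coord]
  rw [hx, Finset.mul_sum, Finset.mul_sum, ← Finset.sum_sub_distrib]
  refine Finset.sum_congr rfl fun i _ => ?_
  simp [EuclideanSpace.inner_single_right]
  ring

lemma GG_cont {w : E n → ℝ} (hw : ContDiff ℝ 1 w) : Continuous (GG w) := by
  unfold GG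
  have := hw.continuous
  have h2 := (hw.continuous_fderiv (by simp)).clm_apply continuous_id
  simp only [id] at h2
  fun_prop

lemma int_mm {f : E n → ℝ} {R : ℝ} (hR : 0 ≤ R) (hf : Continuous f) :
    Integrable (fun x => mm R x * f x) :=
  ((mm_cont R).mul hf).integrable_of_hasCompactSupport (mm_supp hR).mul_right

lemma tot_aux {i1 i2 j1 j2 k1 k2 F : E n → ℝ} (h1 : Integrable i1) (h2 : Integrable i2)
    (h3 : Integrable j1) (h4 : Integrable j2) (h5 : Integrable k1) (h6 : Integrable k2)
    (e1 : ∫ x, i1 x = - ∫ x, j1 x) (e2 : ∫ x, i2 x = - ∫ x, j2 x)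
    (hF : ∀ x, k1 x - k2 x - ((i1 x + i2 x) + (j1 x + j2 x)) = F x) :
    (∫ x, k1 x) - ∫ x, k2 x = ∫ x, F x := by
  have : F = (k1 - k2) - ((i1 + i2) + (j1 + j2)) := funext fun x => (hF x).symm
  rw [this, integral_sub' (h5.sub h6) ((h1.add h2).add (h3.add h4)), integral_sub' h5 h6,
    integral_add' (h1.add h2) (h3.add h4), integral_add' h1 h2, integral_add' h3 h4, e1, e2]
  ring

lemma WW_sub {K : ℝ≥0} {w z : E n → ℝ} {R : ℝ} (hR : 0 ≤ R)
    (hw : ContDiff ℝ 1 w) (hz : ContDiff ℝ 1 z)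
    (hwK : LipschitzWith K (fderiv ℝ w)) (hzK : LipschitzWith K (fderiv ℝ z)) :
    WW R w - WW R z = ∫ x, (w x - z x) * (mm R x ^ 2 * (1 - lap w x) + mm R x ^ 2 * (1 - lap z x)
      + 4 * mm R x * (GG w x + GG z x)) := by
  have hg : ContDiff ℝ 1 (fun x => w x - z x) := hw.sub hz
  have c1 := hw.continuous
  have c2 := hz.continuous
  have c0 := mm_cont (n := n) R
  have d1 : ∀ i : Fin n, Continuous fun x => fderiv ℝ w x (EuclideanSpace.single i 1) :=
    fun i => (lip_part hwK i).continuous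
  have d2 : ∀ i : Fin n, Continuous fun x => fderiv ℝ z x (EuclideanSpace.single i 1) :=
    fun i => (lip_part hzK i).continuous
  have d3 : ∀ i : Fin n, Continuous fun x => fderiv ℝ (fun x => w x - z x) x
    (EuclideanSpace.single i 1) :=
    fun i => (hg.continuous_fderiv (by simp)).clm_apply continuous_const
  have e1 := (hw.continuous_fderiv (by simp)).clm_apply continuous_id
  have e2 := (hz.continuous_fderiv (by simp)).clm_apply continuous_id
  simp only [id] at e1 e2
  have b1 := ibp2 hR hwK hg
  have b2 := ibp2 hR hzK hg
  have hs : HasCompactSupport (fun x : E n => mm R x ^ 2 * (w x - z x)) := by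
    simp_rw [sq, mul_assoc]
    exact (mm_supp hR).mul_right
  have i1 := lap_int hwK (by fun_prop) hs
  have i2 := lap_int hzK (by fun_prop) hs
  have j1 : Integrable fun x => (mm R x ^ 2 *
      ∑ i, fderiv ℝ (fun x => w x - z x) x (EuclideanSpace.single i 1)
        * fderiv ℝ w x (EuclideanSpace.single i 1)
      - 4 * mm R x * (w x - z x) * fderiv ℝ w x x) := by
    refine (int_mm (f := fun x => mm R x *
      ∑ i, fderiv ℝ (fun x => w x - z x) x (EuclideanSpace.single i 1)
        * fderiv ℝ w x (EuclideanSpace.single i 1)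
      - 4 * (w x - z x) * fderiv ℝ w x x) hR (by fun_prop)).congr ?_
    exact Eventually.of_forall fun x => by simp only; ring
  have j2 : Integrable fun x => (mm R x ^ 2 *
      ∑ i, fderiv ℝ (fun x => w x - z x) x (EuclideanSpace.single i 1)
        * fderiv ℝ z x (EuclideanSpace.single i 1)
      - 4 * mm R x * (w x - z x) * fderiv ℝ z x x) := by
    refine (int_mm (f := fun x => mm R x *
      ∑ i, fderiv ℝ (fun x => w x - z x) x (EuclideanSpace.single i 1)
        * fderiv ℝ z x (EuclideanSpace.single i 1)
      - 4 * (w x - z x) * fderiv ℝ z x x) hR (by fun_prop)).congr ?_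
    exact Eventually.of_forall fun x => by simp only; ring
  have k1 : Integrable fun x => (mm R x ^ 2 *
      (∑ i, (fderiv ℝ w x (EuclideanSpace.single i 1)) ^ 2 + 2 * w x) - 8 * mm R x * w x ^ 2) := by
    refine (int_mm (f := fun x => mm R x *
      (∑ i, (fderiv ℝ w x (EuclideanSpace.single i 1)) ^ 2 + 2 * w x) - 8 * w x ^ 2)
      hR (by fun_prop)).congr ?_
    exact Eventually.of_forall fun x => by simp only; ring
  have k2 : Integrable fun x => (mm R x ^ 2 *
      (∑ i, (fderiv ℝ z x (EuclideanSpace.single i 1)) ^ 2 + 2 * z x) - 8 * mm R x * z x ^ 2) := by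
    refine (int_mm (f := fun x => mm R x *
      (∑ i, (fderiv ℝ z x (EuclideanSpace.single i 1)) ^ 2 + 2 * z x) - 8 * z x ^ 2)
      hR (by fun_prop)).congr ?_
    exact Eventually.of_forall fun x => by simp only; ring
  unfold WW
  refine tot_aux i1 i2 j1 j2 k1 k2 b1 b2 fun x => ?_
  have hfd : fderiv ℝ (fun x => w x - z x) x = fderiv ℝ w x - fderiv ℝ z x :=
    fderiv_fun_sub (hw.differentiable (by simp) x) (hz.differentiable (by simp) x)
  have hsum : ∑ i, (fderiv ℝ w x (EuclideanSpace.single i 1)) ^ 2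
      - ∑ i, (fderiv ℝ z x (EuclideanSpace.single i 1)) ^ 2
      = ∑ i, fderiv ℝ (fun x => w x - z x) x (EuclideanSpace.single i 1)
        * fderiv ℝ w x (EuclideanSpace.single i 1)
      + ∑ i, fderiv ℝ (fun x => w x - z x) x (EuclideanSpace.single i 1)
        * fderiv ℝ z x (EuclideanSpace.single i 1) := by
    rw [← Finset.sum_sub_distrib, ← Finset.sum_add_distrib]
    refine Finset.sum_congr rfl fun i _ => ?_
    rw [hfd, sub_apply]; ring
  unfold GG
  linear_combination (mm R x ^ 2) * hsum

/-! ### Rescalings -/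

/-- Quadratic rescaling. -/
def UU (u : E n → ℝ) (r : ℝ) (x : E n) : ℝ := u (r • x) / r ^ 2

/-- The dissipation. -/
def QQ (R : ℝ) (w : E n → ℝ) : ℝ := ∫ x, mm R x * GG w x ^ 2

lemma UU_fderiv {u : E n → ℝ} {r : ℝ} (hr : r ≠ 0) (x : E n) :
    fderiv ℝ (UU u r) x = r⁻¹ • fderiv ℝ u (r • x) := by
  have : UU u r = (r ^ 2)⁻¹ • (fun x => u (r • x)) := by
    ext y; simp [UU, div_eq_inv_mul]
  rw [this, fderiv_const_smul_field, Pi.smul_apply, fderiv_comp_smul, smul_smul]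
  congr 1
  field_simp

lemma UU_contDiff {u : E n → ℝ} (hu : ContDiff ℝ 1 u) (r : ℝ) : ContDiff ℝ 1 (UU u r) := by
  unfold UU
  exact (hu.comp (contDiff_const_smul r)).div_const _

lemma UU_lip {u : E n → ℝ} {K : ℝ≥0} (hK : LipschitzWith K (fderiv ℝ u)) {r : ℝ} (hr : 0 < r) :
    LipschitzWith K (fderiv ℝ (UU u r)) := by
  refine LipschitzWith.of_dist_le_mul fun x y => ?_
  rw [UU_fderiv hr.ne', UU_fderiv hr.ne', dist_eq_norm, ← smul_sub, norm_smul,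
    ← dist_eq_norm]
  have := hK.dist_le_mul (r • x) (r • y)
  rw [dist_smul₀] at this
  rw [Real.norm_eq_abs, abs_of_pos hr] at this
  rw [norm_inv, Real.norm_eq_abs, abs_of_pos hr, inv_mul_le_iff₀ hr]
  linarith

lemma UU_lap {u : E n → ℝ} {r : ℝ} (hr : r ≠ 0) (x : E n) :
    lap (UU u r) x = lap u (r • x) := by
  unfold lap
  refine Finset.sum_congr rfl fun i _ => ?_
  have : (fun y => fderiv ℝ (UU u r) y (EuclideanSpace.single i 1))
      = r⁻¹ • (fun y => (fun z => fderiv ℝ u z (EuclideanSpace.single i 1)) (r • y)) := by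
    ext y; simp [UU_fderiv hr]
  rw [this, fderiv_const_smul_field, Pi.smul_apply,
    fderiv_comp_smul (f := fun z => fderiv ℝ u z (EuclideanSpace.single i 1)), smul_smul,
    inv_mul_cancel₀ hr, one_smul]

lemma UU_GG {u : E n → ℝ} {r : ℝ} (hr : r ≠ 0) (x : E n) :
    GG (UU u r) x = GG u (r • x) / r ^ 2 := by
  unfold GG
  rw [UU_fderiv hr]
  simp [UU]
  field_simp

lemma UU_ae {u : E n → ℝ} {r : ℝ} (hr : r ≠ 0) {C : ℝ}
    (h : ∀ᵐ x, |1 - lap u x| ≤ C ∧ (1 - lap u x) * GG u x = 0) :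
    ∀ᵐ x, |1 - lap (UU u r) x| ≤ C ∧ (1 - lap (UU u r) x) * GG (UU u r) x = 0 := by
  have := (Measure.quasiMeasurePreserving_smul (volume : Measure (E n)) hr).ae h
  filter_upwards [this] with x hx
  rw [UU_lap hr, UU_GG hr]
  exact ⟨hx.1, by rw [← mul_div_assoc, hx.2, zero_div]⟩

lemma fd_bound {u : E n → ℝ} {K : ℝ≥0} (hK : LipschitzWith K (fderiv ℝ u))
    (h1 : fderiv ℝ u 0 = 0) (x : E n) : ‖fderiv ℝ u x‖ ≤ K * ‖x‖ := by
  have := hK.dist_le_mul x 0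
  rwa [h1, dist_zero_right, dist_zero_right] at this

lemma u_bound {u : E n → ℝ} {K : ℝ≥0} (hu : ContDiff ℝ 1 u) (hK : LipschitzWith K (fderiv ℝ u))
    (h0 : u 0 = 0) (h1 : fderiv ℝ u 0 = 0) (x : E n) : |u x| ≤ K * ‖x‖ ^ 2 := by
  have := (convex_closedBall (0 : E n) ‖x‖).norm_image_sub_le_of_norm_fderiv_le (𝕜 := ℝ) (f := u)
    (C := K * ‖x‖) (x := 0) (y := x)
    (fun y _ => hu.differentiable (by simp) y) (fun y hy => ?_) (by simp) (by simp)
  · rw [h0, sub_zero, sub_zero] at this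
    rw [← Real.norm_eq_abs]; linarith
  · refine (fd_bound hK h1 y).trans ?_
    have : ‖y‖ ≤ ‖x‖ := by simpa using hy
    gcongr

lemma GG_bound {u : E n → ℝ} {K : ℝ≥0} (hu : ContDiff ℝ 1 u) (hK : LipschitzWith K (fderiv ℝ u))
    (h0 : u 0 = 0) (h1 : fderiv ℝ u 0 = 0) (x : E n) : |GG u x| ≤ 3 * K * ‖x‖ ^ 2 := by
  unfold GG
  have a1 := u_bound hu hK h0 h1 x
  have a2 := fd_bound hK h1 x
  have a3 := (fderiv ℝ u x).le_opNorm x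
  rw [Real.norm_eq_abs] at a3
  have a4 : ‖fderiv ℝ u x‖ * ‖x‖ ≤ K * ‖x‖ * ‖x‖ := by gcongr
  have a5 := abs_sub (fderiv ℝ u x x) (2 * u x)
  rw [abs_mul, abs_two] at a5
  nlinarith

lemma UU_zero {u : E n → ℝ} (h0 : u 0 = 0) (r : ℝ) : UU u r 0 = 0 := by simp [UU, h0]

lemma UU_fd_zero {u : E n → ℝ} (h1 : fderiv ℝ u 0 = 0) {r : ℝ} (hr : r ≠ 0) :
    fderiv ℝ (UU u r) 0 = 0 := by rw [UU_fderiv hr]; simp [h1]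

lemma UU_hasDerivAt {u : E n → ℝ} (hu : ContDiff ℝ 1 u) {r : ℝ} (hr : r ≠ 0) (x : E n) :
    HasDerivAt (fun s => UU u s x) (GG (UU u r) x / r) r := by
  have h1 : HasDerivAt (fun s : ℝ => s • x) ((1 : ℝ) • x) r := (hasDerivAt_id r).smul_const x
  have h2 := ((hu.differentiable (by simp)) (r • x)).hasFDerivAt.comp_hasDerivAt r h1
  have h3 := h2.div (hasDerivAt_pow 2 r) (pow_ne_zero 2 hr)
  refine h3.congr_deriv ?_
  rw [UU_GG hr]
  simp [GG]
  field_simp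

lemma WW_hasDerivAt {u : E n → ℝ} {K : ℝ≥0} {C R : ℝ} (hR : 0 ≤ R)
    (hu : ContDiff ℝ 1 u) (hK : LipschitzWith K (fderiv ℝ u))
    (h0 : u 0 = 0) (h1 : fderiv ℝ u 0 = 0)
    (h : ∀ᵐ x, |1 - lap u x| ≤ C ∧ (1 - lap u x) * GG u x = 0) {r : ℝ} (hr : 0 < r) :
    HasDerivAt (fun s => WW R (UU u s)) (8 / r * QQ R (UU u r)) r := by
  have hC : 0 ≤ C := by
    obtain ⟨x, hx⟩ := h.exists
    exact (abs_nonneg _).trans hx.1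
  let q : ℝ → E n → ℝ := fun s x => (UU u s x - UU u r x) / (s - r)
  let V : ℝ → E n → ℝ := fun s x => GG (UU u s) x / s
  let B : E n → ℝ := fun x => 6 * K * ‖x‖ ^ 2 / r
  have cU : ∀ s, Continuous (UU u s) := fun s => (UU_contDiff hu s).continuous
  have cG : ∀ s, Continuous (GG (UU u s)) := fun s => GG_cont (UU_contDiff hu s)
  have cq : ∀ s, Continuous (q s) := fun s => ((cU s).sub (cU r)).div_const _
  have cV : ∀ s, Continuous (V s) := fun s => (cG s).div_const _
  have cB : Continuous B := by unfold B; fun_prop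
  have cm := mm_cont (n := n) R
  have gb : ∀ s, 0 < s → ∀ x, |GG (UU u s) x| ≤ 3 * K * ‖x‖ ^ 2 := fun s hs x =>
    GG_bound (UU_contDiff hu s) (UU_lip hK hs) (UU_zero h0 s) (UU_fd_zero h1 hs.ne') x
  have Vb : ∀ s, r / 2 < s → ∀ x, |V s x| ≤ B x := by
    intro s hs x
    have hs0 : 0 < s := by linarith
    simp only [V, B]
    rw [abs_div, abs_of_pos hs0, div_le_div_iff₀ hs0 hr]
    have := gb s hs0 x
    have h3 : 0 ≤ 3 * (K : ℝ) * ‖x‖ ^ 2 := by positivity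
    nlinarith [abs_nonneg (GG (UU u s) x)]
  have qb : ∀ s, r / 2 < s → s ≠ r → ∀ x, |q s x| ≤ B x := by
    intro s hs hsr x
    have := (convex_Ioi (r / 2)).norm_image_sub_le_of_norm_hasDerivWithin_le
      (f := fun s => UU u s x) (f' := fun s => V s x) (C := B x) (x := r) (y := s)
      (fun t ht => (UU_hasDerivAt hu (by have : r / 2 < t := ht
                                         linarith) x).hasDerivWithinAt)
      (fun t ht => Vb t ht x) (mem_Ioi.2 (by linarith)) (mem_Ioi.2 hs)
    simp only [q]
    rw [abs_div, div_le_iff₀ (abs_pos.2 (sub_ne_zero.2 hsr))]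
    simpa using this
  have ev : ∀ᶠ s in nhdsWithin r {r}ᶜ, r / 2 < s ∧ s ≠ r := by
    refine (eventually_nhdsWithin_of_eventually_nhds (lt_mem_nhds (by linarith))).and ?_
    exact eventually_mem_nhdsWithin
  have tq : ∀ x, Tendsto (fun s => q s x) (nhdsWithin r {r}ᶜ) (nhds (V r x)) := by
    intro x
    have := (hasDerivAt_iff_tendsto_slope.1 (UU_hasDerivAt hu hr.ne' x))
    refine this.congr fun s => ?_
    simp [slope_def_field, q]
  have tG : ∀ x, Tendsto (fun s => GG (UU u s) x) (nhdsWithin r {r}ᶜ)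
      (nhds (GG (UU u r) x)) := by
    intro x
    refine Tendsto.mono_left ?_ nhdsWithin_le_nhds
    have h5 : ContinuousAt (fun s : ℝ => GG u (s • x) / s ^ 2) r := by
      refine ContinuousAt.div ?_ (by fun_prop) (pow_ne_zero 2 hr.ne')
      exact ((GG_cont hu).comp (continuous_id.smul continuous_const)).continuousAt
    have h6 := h5.tendsto
    rw [← UU_GG hr.ne'] at h6
    refine h6.congr' ?_
    filter_upwards [lt_mem_nhds hr] with s hs
    rw [UU_GG hs.ne']
  have tV : ∀ x, Tendsto (fun s => V s x) (nhdsWithin r {r}ᶜ) (nhds (V r x)) := by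
    intro x
    exact (tG x).div (tendsto_id.mono_left nhdsWithin_le_nhds) hr.ne'
  have T1 : Tendsto (fun s => ∫ x, mm R x * (C * mm R x * (|q s x - V s x| + |q s x - V r x|)))
      (nhdsWithin r {r}ᶜ) (nhds 0) := by
    have : (0 : ℝ) = ∫ x : E n, (0 : ℝ) := by simp
    rw [this]
    refine tendsto_integral_filter_of_dominated_convergence
      (fun x => mm R x * (C * mm R x * (4 * B x))) ?_ ?_ ?_ ?_
    · refine Eventually.of_forall fun s => Continuous.aestronglyMeasurable ?_
      have := cq s; have := cV s; have := cV r
      fun_prop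
    · filter_upwards [ev] with s hs
      refine Eventually.of_forall fun x => ?_
      have m0 := mm_nonneg R x
      rw [Real.norm_eq_abs, abs_of_nonneg (by positivity)]
      have a1 := qb s hs.1 hs.2 x
      have a2 := Vb s hs.1 x
      have a3 := Vb r (by linarith) x
      have a4 := abs_sub (q s x) (V s x)
      have a5 := abs_sub (q s x) (V r x)
      gcongr
      linarith
    · exact int_mm hR (by fun_prop)
    · refine Eventually.of_forall fun x => ?_
      have b1 := ((tq x).sub (tV x)).abs
      have b2 := ((tq x).sub_const (V r x)).abs
      have b3 := ((b1.add b2).const_mul (C * mm R x)).const_mul (mm R x)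
      simpa using b3
  have T2 : Tendsto (fun s => ∫ x, mm R x * (4 * q s x * (GG (UU u s) x + GG (UU u r) x)))
      (nhdsWithin r {r}ᶜ) (nhds (8 / r * QQ R (UU u r))) := by
    have : 8 / r * QQ R (UU u r) = ∫ x : E n, mm R x * (4 * V r x *
        (GG (UU u r) x + GG (UU u r) x)) := by
      unfold QQ
      rw [← integral_const_mul]
      congr 1; ext x
      simp only [V]; field_simp; ring
    rw [this]
    refine tendsto_integral_filter_of_dominated_convergence
      (fun x => mm R x * (4 * B x * (6 * K * ‖x‖ ^ 2))) ?_ ?_ ?_ ?_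
    · refine Eventually.of_forall fun s => Continuous.aestronglyMeasurable ?_
      have := cq s; have := cG s; have := cG r
      fun_prop
    · filter_upwards [ev] with s hs
      refine Eventually.of_forall fun x => ?_
      have m0 := mm_nonneg R x
      have a1 := qb s hs.1 hs.2 x
      have a2 := gb s (by linarith [hs.1]) x
      have a3 := gb r hr x
      have a4 := abs_add_le (GG (UU u s) x) (GG (UU u r) x)
      rw [Real.norm_eq_abs, abs_mul, abs_of_nonneg m0, abs_mul, abs_mul, abs_of_pos (four_pos)]
      have hB : 0 ≤ B x := (abs_nonneg _).trans a1
      refine mul_le_mul_of_nonneg_left (mul_le_mul ?_ ?_ (abs_nonneg _) ?_) m0 <;> linarith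
    · exact int_mm hR (by fun_prop)
    · refine Eventually.of_forall fun x => ?_
      exact (((tq x).const_mul 4).mul ((tG x).add_const _)).const_mul _
  rw [hasDerivAt_iff_tendsto_slope]
  have T3 : Tendsto (fun s => slope (fun s => WW R (UU u s)) r s
      - ∫ x, mm R x * (4 * q s x * (GG (UU u s) x + GG (UU u r) x))) (nhdsWithin r {r}ᶜ)
      (nhds 0) := by
    refine squeeze_zero_norm' ?_ T1
    filter_upwards [ev] with s hs
    have hs0 : 0 < s := by linarith [hs.1]
    have hη : Continuous fun x => mm R x ^ 2 * q s x := by have := cq s; fun_prop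
    have hsη : HasCompactSupport fun x => mm R x ^ 2 * q s x := by
      simp_rw [sq, mul_assoc]
      exact (mm_supp hR).mul_right
    have i0 := hη.integrable_of_hasCompactSupport (μ := volume) hsη
    have i1 := lap_int (UU_lip hK hs0) hη hsη
    have i2 := lap_int (UU_lip hK hr) hη hsη
    have i3 : Integrable fun x => mm R x * (4 * q s x * (GG (UU u s) x + GG (UU u r) x)) :=
      int_mm hR (by have := cq s; have := cG s; have := cG r; fun_prop)
    have e : slope (fun s => WW R (UU u s)) r s
      - ∫ x, mm R x * (4 * q s x * (GG (UU u s) x + GG (UU u r) x))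
      = ∫ x, (mm R x ^ 2 * q s x) * ((1 - lap (UU u s) x) + (1 - lap (UU u r) x)) := by
      rw [slope_def_field, WW_sub hR (UU_contDiff hu s) (UU_contDiff hu r) (UU_lip hK hs0)
        (UU_lip hK hr), ← integral_div]
      have i4 : Integrable fun x => (mm R x ^ 2 * q s x) * ((1 - lap (UU u s) x)
          + (1 - lap (UU u r) x)) := by
        refine (((i0.sub i1).add (i0.sub i2))).congr (Eventually.of_forall fun x => ?_)
        simp only [Pi.add_apply, Pi.sub_apply]; ring
      rw [sub_eq_iff_eq_add, ← integral_add i4 i3]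
      congr 1; ext x
      simp only [q]; ring
    rw [e]
    refine norm_integral_le_of_norm_le (int_mm hR ?_) ?_
    · have := cq s; have := cV s; have := cV r
      fun_prop
    · filter_upwards [UU_ae hs0.ne' h, UU_ae hr.ne' h] with x hx1 hx2
      have e1 : (1 - lap (UU u s) x) * V s x = 0 := by
        simp only [V]; rw [← mul_div_assoc, hx1.2, zero_div]
      have e2 : (1 - lap (UU u r) x) * V r x = 0 := by
        simp only [V]; rw [← mul_div_assoc, hx2.2, zero_div]
      have e3 : (mm R x ^ 2 * q s x) * ((1 - lap (UU u s) x) + (1 - lap (UU u r) x))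
        = mm R x * (mm R x * ((1 - lap (UU u s) x) * (q s x - V s x)
          + (1 - lap (UU u r) x) * (q s x - V r x))) := by
        linear_combination (mm R x ^ 2) * (e1 + e2)
      have m0 := mm_nonneg R x
      rw [e3, Real.norm_eq_abs, abs_mul, abs_mul, abs_of_nonneg m0]
      have e4 := abs_add_le ((1 - lap (UU u s) x) * (q s x - V s x))
        ((1 - lap (UU u r) x) * (q s x - V r x))
      rw [abs_mul, abs_mul] at e4
      have e5 : |1 - lap (UU u s) x| * |q s x - V s x| ≤ C * |q s x - V s x| := by
        gcongr; exact hx1.1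
      have e6 : |1 - lap (UU u r) x| * |q s x - V r x| ≤ C * |q s x - V r x| := by
        gcongr; exact hx2.1
      have e7 : C * mm R x * (|q s x - V s x| + |q s x - V r x|)
        = mm R x * (C * |q s x - V s x| + C * |q s x - V r x|) := by ring
      rw [e7]
      gcongr
      linarith
  have := T3.add T2
  simpa using this

/-! ### Monotonicity and limits -/

lemma QQ_nonneg (R : ℝ) (w : E n → ℝ) : 0 ≤ QQ R w :=
  integral_nonneg fun x => mul_nonneg (mm_nonneg R x) (sq_nonneg _)

lemma WW_bound {u : E n → ℝ} {K : ℝ≥0} {R : ℝ} (hR : 0 ≤ R)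
    (hu : ContDiff ℝ 1 u) (hK : LipschitzWith K (fderiv ℝ u))
    (h0 : u 0 = 0) (h1 : fderiv ℝ u 0 = 0) :
    |WW R u| ≤ ∫ x : E n, mm R x * (mm R x * (∑ _i : Fin n, (K * ‖x‖) ^ 2 + 2 * (K * ‖x‖ ^ 2))
      + 8 * (K * ‖x‖ ^ 2) ^ 2) := by
  unfold WW
  rw [← Real.norm_eq_abs]
  have cm := mm_cont (n := n) R
  refine norm_integral_le_of_norm_le (int_mm hR (by fun_prop)) (Eventually.of_forall fun x => ?_)
  have m0 := mm_nonneg R x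
  have ub := u_bound hu hK h0 h1 x
  have hs : ∑ i, (fderiv ℝ u x (EuclideanSpace.single i 1)) ^ 2 ≤ ∑ _i : Fin n, (K * ‖x‖) ^ 2 := by
    refine Finset.sum_le_sum fun i _ => ?_
    have a := (fderiv ℝ u x).le_opNorm (EuclideanSpace.single i 1)
    rw [norm_single_one, mul_one, Real.norm_eq_abs] at a
    rw [← sq_abs]
    gcongr
    exact a.trans (fd_bound hK h1 x)
  have hs0 : 0 ≤ ∑ i, (fderiv ℝ u x (EuclideanSpace.single i 1)) ^ 2 :=
    Finset.sum_nonneg fun i _ => sq_nonneg _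
  have h2 : u x ^ 2 ≤ (K * ‖x‖ ^ 2) ^ 2 := by rw [← sq_abs (u x)]; gcongr
  have e : mm R x ^ 2 * (∑ i, (fderiv ℝ u x (EuclideanSpace.single i 1)) ^ 2 + 2 * u x)
    - 8 * mm R x * u x ^ 2 = mm R x * (mm R x *
      (∑ i, (fderiv ℝ u x (EuclideanSpace.single i 1)) ^ 2 + 2 * u x) - 8 * u x ^ 2) := by ring
  rw [e, Real.norm_eq_abs, abs_mul, abs_of_nonneg m0]
  refine mul_le_mul_of_nonneg_left ?_ m0
  refine (abs_sub _ _).trans ?_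
  rw [abs_mul, abs_of_nonneg m0, abs_mul, abs_of_nonneg (sq_nonneg (u x)), abs_of_pos (by norm_num : (0:ℝ) < 8)]
  have h3 : |∑ i, (fderiv ℝ u x (EuclideanSpace.single i 1)) ^ 2 + 2 * u x|
      ≤ ∑ _i : Fin n, (K * ‖x‖) ^ 2 + 2 * (K * ‖x‖ ^ 2) := by
    refine (abs_add_le _ _).trans ?_
    rw [abs_of_nonneg hs0, abs_mul, abs_two]
    linarith
  have h4 := mul_le_mul_of_nonneg_left h3 m0
  linarith

lemma QQ_scale {u : E n → ℝ} {R : ℝ} (hR : 0 ≤ R) (hu : ContDiff ℝ 1 u) {l s : ℝ} (hl : 0 < l)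
    (h1 : 1 ≤ s) (h2 : s ≤ 2) :
    QQ R (UU u l) ≤ 2 ^ (n + 4) * QQ R (UU u (s * l)) := by
  have s0 : 0 < s := by linarith
  have cG : Continuous (GG (UU u l)) := GG_cont (UU_contDiff hu l)
  have cm := mm_cont (n := n) R
  have e : QQ R (UU u (s * l)) = ∫ x, (fun y => mm R (s⁻¹ • y) * GG (UU u l) y ^ 2 / s ^ 4)
      (s • x) := by
    unfold QQ
    congr 1; ext x
    simp only
    rw [smul_smul, inv_mul_cancel₀ s0.ne', one_smul, UU_GG (mul_pos s0 hl).ne', UU_GG hl.ne',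
      smul_smul, mul_comm l s]
    field_simp
  rw [Measure.integral_comp_smul volume
    (fun y : E n => mm R (s⁻¹ • y) * GG (UU u l) y ^ 2 / s ^ 4) s, finrank_euclideanSpace_fin, abs_of_pos (by positivity),
    integral_div, smul_eq_mul] at e
  have mono : QQ R (UU u l) ≤ ∫ y, mm R (s⁻¹ • y) * GG (UU u l) y ^ 2 := by
    unfold QQ
    refine integral_mono (int_mm hR (by fun_prop)) ?_ fun y => ?_
    · refine Continuous.integrable_of_hasCompactSupport (by fun_prop) ?_
      refine HasCompactSupport.mul_right ?_
      exact (mm_supp hR).comp_homeomorph (Homeomorph.smulOfNeZero s⁻¹ (inv_ne_zero s0.ne'))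
    · refine mul_le_mul_of_nonneg_right ?_ (sq_nonneg _)
      unfold mm
      refine max_le_max_right _ ?_
      rw [norm_smul, norm_inv, Real.norm_eq_abs, abs_of_pos s0]
      have : s⁻¹ * ‖y‖ ≤ ‖y‖ := by
        rw [inv_mul_le_iff₀ s0]; nlinarith [norm_nonneg y]
      have h0 : 0 ≤ s⁻¹ * ‖y‖ := by positivity
      nlinarith
  have e2 : ∫ y, mm R (s⁻¹ • y) * GG (UU u l) y ^ 2 = s ^ (n + 4) * QQ R (UU u (s * l)) := by
    rw [e, pow_add]
    field_simp
  rw [e2] at mono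
  refine mono.trans ?_
  have := QQ_nonneg R (UU u (s * l))
  gcongr

lemma QQ_tendsto {u : E n → ℝ} {K : ℝ≥0} {C R : ℝ} (hR : 0 ≤ R)
    (hu : ContDiff ℝ 1 u) (hK : LipschitzWith K (fderiv ℝ u))
    (h0 : u 0 = 0) (h1 : fderiv ℝ u 0 = 0)
    (h : ∀ᵐ x, |1 - lap u x| ≤ C ∧ (1 - lap u x) * GG u x = 0)
    {l : ℕ → ℝ} (hl : ∀ j, 0 < l j)
    (hlim : Tendsto l atTop (nhds 0) ∨ Tendsto l atTop atTop) :
    Tendsto (fun j => QQ R (UU u (l j))) atTop (nhds 0) := by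
  have hW : ∀ r, 0 < r → HasDerivAt (fun s => WW R (UU u s)) (8 / r * QQ R (UU u r)) r :=
    fun r hr => WW_hasDerivAt hR hu hK h0 h1 h hr
  obtain ⟨A, hA⟩ : ∃ A, ∀ r, 0 < r → |WW R (UU u r)| ≤ A :=
    ⟨_, fun r hr => WW_bound hR (UU_contDiff hu r) (UU_lip hK hr) (UU_zero h0 r)
      (UU_fd_zero h1 hr.ne')⟩
  let T : ℝ → ℝ := fun t => WW R (UU u (Real.exp t))
  have hT : ∀ t, HasDerivAt T (8 / Real.exp t * QQ R (UU u (Real.exp t)) * Real.exp t) t :=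
    fun t => (hW _ (Real.exp_pos t)).comp t (Real.hasDerivAt_exp t)
  have mono : Monotone T := by
    refine monotone_of_deriv_nonneg (fun t => (hT t).differentiableAt) fun t => ?_
    rw [(hT t).deriv]
    have := QQ_nonneg R (UU u (Real.exp t))
    positivity
  have hlog : Tendsto (fun j => Real.log (l j)) atTop atBot
      ∨ Tendsto (fun j => Real.log (l j)) atTop atTop := by
    rcases hlim with hh | hh
    · left
      refine Real.tendsto_log_nhdsGT_zero.comp ?_
      rw [tendsto_nhdsWithin_iff]
      exact ⟨hh, Eventually.of_forall hl⟩
    · right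
      exact Real.tendsto_log_atTop.comp hh
  have key : Tendsto (fun j => T (Real.log (l j) + Real.log 2) - T (Real.log (l j))) atTop
      (nhds 0) := by
    rcases hlog with hh | hh
    · have hb : BddBelow (range T) := ⟨-A, by
        rintro _ ⟨t, rfl⟩; exact (abs_le.1 (hA _ (Real.exp_pos t))).1⟩
      have ht := tendsto_atBot_ciInf mono hb
      have := (ht.comp (tendsto_atBot_add_const_right _ (Real.log 2) hh)).sub (ht.comp hh)
      simpa using this
    · have hb : BddAbove (range T) := ⟨A, by
        rintro _ ⟨t, rfl⟩; exact (abs_le.1 (hA _ (Real.exp_pos t))).2⟩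
      have ht := tendsto_atTop_ciSup mono hb
      have := (ht.comp (tendsto_atTop_add_const_right _ (Real.log 2) hh)).sub (ht.comp hh)
      simpa using this
  have key2 := key.const_mul ((2 : ℝ) ^ (n + 4))
  rw [mul_zero] at key2
  refine squeeze_zero (fun j => QQ_nonneg R _) (fun j => ?_) key2
  have lp := hl j
  have eT : T (Real.log (l j) + Real.log 2) - T (Real.log (l j))
      = WW R (UU u (2 * l j)) - WW R (UU u (l j)) := by
    simp only [T]
    rw [Real.exp_add, Real.exp_log lp, Real.exp_log two_pos, mul_comm]
  rw [eT]
  obtain ⟨c, hc, he⟩ := exists_hasDerivAt_eq_slope (fun s => WW R (UU u s))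
    (fun r => 8 / r * QQ R (UU u r)) (by linarith : l j < 2 * l j)
    (fun r hr => (hW r (lt_of_lt_of_le lp hr.1)).continuousAt.continuousWithinAt)
    (fun r hr => hW r (lt_trans lp hr.1))
  have cp : 0 < c := lt_trans lp hc.1
  have hs := QQ_scale (s := c / l j) hR hu lp ((one_le_div lp).2 hc.1.le)
    ((div_le_iff₀ lp).2 hc.2.le)
  rw [div_mul_cancel₀ _ lp.ne'] at hs
  refine hs.trans ?_
  have hq := QQ_nonneg R (UU u c)
  have : QQ R (UU u c) ≤ WW R (UU u (2 * l j)) - WW R (UU u (l j)) := by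
    have e2 : WW R (UU u (2 * l j)) - WW R (UU u (l j)) = (8 * l j / c) * QQ R (UU u c) := by
      have : 2 * l j - l j = l j := by ring
      rw [this] at he
      field_simp at he ⊢
      linarith
    rw [e2]
    have : 1 ≤ 8 * l j / c := by rw [one_le_div cp]; linarith [hc.2]
    nlinarith
  gcongr

lemma final {u u₀ : E n → ℝ} {K : ℝ≥0} {C : ℝ}
    (hu : ContDiff ℝ 1 u) (hK : LipschitzWith K (fderiv ℝ u))
    (h0 : u 0 = 0) (h1 : fderiv ℝ u 0 = 0)
    (h : ∀ᵐ x, |1 - lap u x| ≤ C ∧ (1 - lap u x) * GG u x = 0)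
    {l : ℕ → ℝ} (hl : ∀ j, 0 < l j)
    (hlim : Tendsto l atTop (nhds 0) ∨ Tendsto l atTop atTop)
    (hconv : ∀ R : ℝ, 0 < R → ∀ ε : ℝ, 0 < ε → ∃ N, ∀ j ≥ N, ∀ x ∈ closedBall (0 : E n) R,
      |UU u (l j) x - u₀ x| ≤ ε ∧ ‖fderiv ℝ (UU u (l j)) x - fderiv ℝ u₀ x‖ ≤ ε)
    (x : E n) (t : ℝ) (ht : 0 < t) : u₀ (t • x) = t ^ 2 * u₀ x := by
  have p1 : ∀ x, Tendsto (fun j => UU u (l j) x) atTop (nhds (u₀ x)) := by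
    intro x
    rw [Metric.tendsto_atTop]
    intro ε hε
    obtain ⟨N, hN⟩ := hconv (‖x‖ + 1) (by positivity) (ε / 2) (by positivity)
    refine ⟨N, fun j hj => ?_⟩
    have := (hN j hj x (by simp)).1
    rw [Real.dist_eq]; linarith
  have p2 : ∀ x, Tendsto (fun j => fderiv ℝ (UU u (l j)) x) atTop (nhds (fderiv ℝ u₀ x)) := by
    intro x
    rw [Metric.tendsto_atTop]
    intro ε hε
    obtain ⟨N, hN⟩ := hconv (‖x‖ + 1) (by positivity) (ε / 2) (by positivity)
    refine ⟨N, fun j hj => ?_⟩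
    have := (hN j hj x (by simp)).2
    rw [dist_eq_norm]; linarith
  have hd : ∀ x, HasFDerivAt u₀ (fderiv ℝ u₀ x) x := by
    intro x
    refine hasFDerivAt_of_tendstoUniformlyOn (s := ball (0 : E n) (‖x‖ + 1)) (l := atTop)
      (f := fun j => UU u (l j)) (f' := fun j => fderiv ℝ (UU u (l j))) isOpen_ball ?_ ?_ ?_
      (by simp)
    · rw [Metric.tendstoUniformlyOn_iff]
      intro ε hε
      obtain ⟨N, hN⟩ := hconv (‖x‖ + 1) (by positivity) (ε / 2) (by positivity)
      filter_upwards [eventually_ge_atTop N] with j hj y hy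
      have := (hN j hj y (ball_subset_closedBall hy)).2
      rw [dist_comm, dist_eq_norm]; linarith
    · exact fun j y _ => ((UU_contDiff hu (l j)).differentiable (by simp) y).hasFDerivAt
    · exact fun y _ => p1 y
  have hL : LipschitzWith K (fderiv ℝ u₀) := by
    refine LipschitzWith.of_dist_le_mul fun x y => ?_
    exact le_of_tendsto ((p2 x).dist (p2 y))
      (Eventually.of_forall fun j => (UU_lip hK (hl j)).dist_le_mul x y)
  have hc : ContDiff ℝ 1 u₀ :=
    contDiff_one_iff_fderiv.2 ⟨fun x => (hd x).differentiableAt, hL.continuous⟩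
  have hG : ∀ x, GG u₀ x = 0 := by
    intro x
    have hR : (0 : ℝ) ≤ ‖x‖ + 1 := by positivity
    have T0 := QQ_tendsto hR hu hK h0 h1 h hl hlim
    have cG := GG_cont hc
    have cm := mm_cont (n := n) (‖x‖ + 1)
    have T1 : Tendsto (fun j => QQ (‖x‖ + 1) (UU u (l j))) atTop (nhds (QQ (‖x‖ + 1) u₀)) := by
      unfold QQ
      refine tendsto_integral_of_dominated_convergence
        (fun y => mm (‖x‖ + 1) y * (3 * K * ‖y‖ ^ 2) ^ 2) ?_ (int_mm hR (by fun_prop)) ?_ ?_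
      · intro j
        have := GG_cont (UU_contDiff hu (l j))
        exact Continuous.aestronglyMeasurable (by fun_prop)
      · refine fun j => Eventually.of_forall fun y => ?_
        have m0 := mm_nonneg (‖x‖ + 1) y
        rw [Real.norm_eq_abs, abs_of_nonneg (by positivity), ← sq_abs (GG _ _)]
        have := GG_bound (UU_contDiff hu (l j)) (UU_lip hK (hl j)) (UU_zero h0 _)
          (UU_fd_zero h1 (hl j).ne') y
        gcongr
      · refine Eventually.of_forall fun y => ?_
        unfold GG
        have p3 : Tendsto (fun j => fderiv ℝ (UU u (l j)) y y) atTop (nhds (fderiv ℝ u₀ y y)) :=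
          ((ContinuousLinearMap.apply ℝ ℝ y).continuous.tendsto _).comp (p2 y)
        exact ((p3.sub ((p1 y).const_mul 2)).pow 2).const_mul _
    have hQ := tendsto_nhds_unique T1 T0
    unfold QQ at hQ
    rw [integral_eq_zero_iff_of_nonneg
      (fun y => mul_nonneg (mm_nonneg _ y) (sq_nonneg _)) (int_mm hR (cG.pow 2))] at hQ
    have cf : Continuous fun y => mm (‖x‖ + 1) y * GG u₀ y ^ 2 := by fun_prop
    have := congrFun (Measure.eq_of_ae_eq hQ cf continuous_zero) x
    simp only [Pi.zero_apply] at this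
    have mp : 0 < mm (‖x‖ + 1) x := by
      unfold mm; refine lt_max_of_lt_left ?_; nlinarith [norm_nonneg x]
    rcases mul_eq_zero.1 this with h3 | h3
    · exact absurd h3 mp.ne'
    · exact pow_eq_zero_iff (two_ne_zero) |>.1 h3
  have hder : ∀ s ∈ Ioi (0 : ℝ), HasDerivWithinAt (fun s => UU u₀ s x) 0 (Ioi 0) s := by
    intro s hs
    have hs' : s ≠ 0 := (mem_Ioi.1 hs).ne'
    have := UU_hasDerivAt hc hs' x
    rw [UU_GG hs', hG] at this
    simpa using this.hasDerivWithinAt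
  have := (convex_Ioi (0 : ℝ)).norm_image_sub_le_of_norm_hasDerivWithin_le (C := 0) hder
    (by simp) (mem_Ioi.2 one_pos) (mem_Ioi.2 ht)
  rw [zero_mul] at this
  have h5 := sub_eq_zero.1 (norm_le_zero_iff.1 this)
  simp only [UU, one_smul, one_pow, div_one] at h5
  rw [← h5]; field_simp

/-- **Homogeneity of blowups and shrink-downs.** For `ψ(x) = (a/2)(x₁⁺)²`, `a > 1`, and
`u ∈ P_∞(M)` solving `Δu = χ_{{0<u<ψ}} + Δψ·χ_{{0<u=ψ}}` a.e. in `ℝⁿ`, every blowup and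
every shrink-down of `u` at `0` is homogeneous of degree two. -/
theorem blowup_homogeneous (n : ℕ) (M a : ℝ) (u ψ : E (n + 2) → ℝ)
    (hpsi : ψ = fun x => a / 2 * max (x 0) 0 ^ 2)
    (hP : Pinf (n + 2) M a u ψ)
    (heq : ∀ᵐ x : E (n + 2),
      lap u x = ({y | 0 < u y ∧ u y < ψ y}).indicator (fun _ => (1 : ℝ)) x
        + ({y | 0 < u y ∧ u y = ψ y}).indicator (lap ψ) x) :
    ∀ u₀ : E (n + 2) → ℝ, (IsBlowupAt u 0 u₀ ∨ IsShrinkdownAt u 0 u₀) →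
      ∀ (x : E (n + 2)) (l : ℝ), 0 < l → u₀ (l • x) = l ^ 2 * u₀ x := by
  intro u₀ hu₀ x l hl
  have hψ1 : Differentiable ℝ ψ := hP.psi_c1.differentiable (by simp)
  have hu1 : Differentiable ℝ u := hP.u_c1.differentiable (by simp)
  have gz : ∀ y, gradient u y = 0 ↔ fderiv ℝ u y = 0 := by
    intro y
    simp [gradient]
  have hclosed : IsClosed (Lam univ u) := by
    have : Lam univ u = {y | u y = 0} ∩ {y | fderiv ℝ u y = 0} := by
      ext y; simp [Lam, gz]
    rw [this]
    exact (isClosed_eq hP.u_c1.continuous continuous_const).inter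
      (isClosed_eq hP.u_c11.continuous continuous_const)
  have hz : (0 : E (n + 2)) ∈ Lam univ u := hclosed.frontier_subset hP.zero_mem
  have h0 : u 0 = 0 := hz.2.1
  have h1 : fderiv ℝ u 0 = 0 := (gz 0).1 hz.2.2
  have hψG : ∀ y, GG ψ y = 0 := by
    intro y
    have hh : ∀ᶠ s in nhds (1 : ℝ), UU ψ s y = ψ y := by
      filter_upwards [lt_mem_nhds (one_pos)] with s hs
      simp only [UU, hpsi, PiLp.smul_apply, smul_eq_mul]
      have : max (s * y 0) 0 = s * max (y 0) 0 := by
        rw [mul_max_of_nonneg _ _ hs.le, mul_zero]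
      rw [this]; field_simp
    have d1 := UU_hasDerivAt hP.psi_c1 one_ne_zero y
    have d2 : HasDerivAt (fun s => UU ψ s y) 0 1 :=
      (hasDerivAt_const (1 : ℝ) (ψ y)).congr_of_eventuallyEq hh
    have := d1.unique d2
    rw [UU_GG one_ne_zero] at this
    simpa using this
  have hae : ∀ᵐ y, |1 - lap u y| ≤ 1 + a ∧ (1 - lap u y) * GG u y = 0 := by
    have ha := hP.ha
    filter_upwards [hP.u_eq] with y hy
    by_cases hL : y ∈ Lam univ u
    · have e1 : u y = 0 := hL.2.1
      have e2 : fderiv ℝ u y = 0 := (gz y).1 hL.2.2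
      have e3 : GG u y = 0 := by simp [GG, e1, e2]
      have e4 : lap u y = 0 := by rw [hy]; simp [Om, hL]
      rw [e3, e4]
      refine ⟨?_, by simp⟩
      rw [sub_zero, abs_one]; linarith
    · have hO : y ∈ Om univ u := ⟨mem_univ _, hL⟩
      rcases (hP.u_le y).lt_or_eq with hlt | heq'
      · have e4 : lap u y = 1 := by
          rw [hy, indicator_of_mem (show y ∈ Om univ u ∩ {y | u y < ψ y} from ⟨hO, hlt⟩),
            indicator_of_notMem (fun h => hlt.ne h.2), add_zero]
        rw [e4]
        simp; linarith
      · have e4 : lap u y = a := by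
          rw [hy, indicator_of_notMem (fun h => h.2.ne heq'),
            indicator_of_mem (show y ∈ Om univ u ∩ {y | u y = ψ y} from ⟨hO, heq'⟩), zero_add]
        have hmin : IsLocalMin (fun y => ψ y - u y) y :=
          Eventually.of_forall fun z => by simp only [heq', sub_self]; linarith [hP.u_le z]
        have e5 := hmin.fderiv_eq_zero
        rw [fderiv_fun_sub (hψ1 y) (hu1 y), sub_eq_zero] at e5
        have e6 : GG u y = 0 := by
          have := hψG y
          unfold GG at this ⊢
          rw [← e5, heq', this]
        rw [e6, mul_zero, e4]
        refine ⟨?_, rfl⟩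
        rw [abs_le]; constructor <;> linarith
  have hres : ∀ r, rescale u 0 r = UU u r := by
    intro r; ext y; simp [rescale, UU, h0]
  rcases hu₀ with ⟨L, hL, hlim, hc⟩ | ⟨L, hL, hlim, hc⟩
  · refine final hP.u_c1 hP.u_c11 h0 h1 hae hL (Or.inl hlim) ?_ x l hl
    intro R hR ε hε
    obtain ⟨N, hN⟩ := hc (1 / 2) (by norm_num) (by norm_num) R hR ε hε
    refine ⟨N, fun j hj y hy => ?_⟩
    have := hN j hj y hy
    rw [hres] at this
    exact ⟨this.1, this.2.1⟩
  · refine final hP.u_c1 hP.u_c11 h0 h1 hae hL (Or.inr hlim) ?_ x l hl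
    intro R hR ε hε
    obtain ⟨N, hN⟩ := hc (1 / 2) (by norm_num) (by norm_num) R hR ε hε
    refine ⟨N, fun j hj y hy => ?_⟩
    have := hN j hj y hy
    rw [hres] at this
    exact ⟨this.1, this.2.1⟩
end
end

section
/- (Classification of homogeneous two-dimensional global solutions.) Let n = 2, a > 1, ψ(x) = (a/2)(x₁⁺)², and let u ∈ P_∞(M) satisfy Δu = χ_{{0<u<ψ}} + a·χ_{{0<u=ψ}} and 0 ≤ u ≤ ψ almost everywhere in ℝ². Suppose u is homogeneous of degree two, i.e., u(λx) = λ²u(x) for all x ∈ ℝ² and λ > 0. Then either u(x) = (1/2)(x₁⁺)² or u(x) = (a/2)(x₁⁺)². -/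
/- Setting: the double obstacle problem
   Δu = f·χ_{Ω(u)∩{u<ψ}} + Δψ·χ_{Ω(u)∩{u=ψ}},  u ≤ ψ,
   following "Regularity of the free boundary for the double obstacle problem". -/

open Set Metric MeasureTheory Filter
open scoped RealInnerProductSpace NNReal

noncomputable section

variable {n : ℕ}

theorem ode_smooth (g g1 k : ℝ → ℝ) (K : ℝ≥0) (hL : LipschitzWith K g1) (I : Set ℝ)
    (hIo : IsOpen I) (hIc : I.OrdConnected) (hk : Continuous k)
    (hode : ∀ᵐ t, t ∈ I → deriv g1 t = k t) (t : ℝ) (ht : t ∈ I) : HasDerivAt g1 (k t) t := by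
  have key : ∀ s ∈ I, g1 s = g1 t + ∫ x in t..s, k x := by
    intro s hs
    have h1 := (hL.lipschitzOnWith (s := uIcc t s)).absolutelyContinuousOnInterval.integral_deriv_eq_sub
    have h2 : ∫ x in t..s, deriv g1 x = ∫ x in t..s, k x := by
      apply intervalIntegral.integral_congr_ae
      filter_upwards [hode] with x hx hxs
      exact hx (hIc.uIcc_subset ht hs (uIoc_subset_uIcc hxs))
    linarith
  have h3 : HasDerivAt (fun s => g1 t + ∫ x in t..s, k x) (k t) t :=
    (hk.integral_hasStrictDerivAt t t).hasDerivAt.const_add _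
  refine h3.congr_of_eventuallyEq ?_
  filter_upwards [hIo.mem_nhds ht] with s hs using key s hs

theorem ode_quad (g g1 : ℝ → ℝ) (hg : ∀ t, HasDerivAt g (g1 t) t)
    (K : ℝ≥0) (hL : LipschitzWith K g1) (I : Set ℝ)
    (hIo : IsOpen I) (hIc : I.OrdConnected)
    (hode : ∀ᵐ t, t ∈ I → deriv g1 t = (1 + 2 * t * g1 t - 2 * g t) / (1 + t ^ 2)) :
    ∃ k b : ℝ, ∀ t ∈ I, g1 t = k * t + b ∧ g t = (1 - k) / 2 + b * t + k / 2 * t ^ 2 := by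
  have hgc : Continuous g := continuous_iff_continuousAt.2 fun t => (hg t).continuousAt
  have hgc1 : Continuous g1 := hL.continuous
  have hpos : ∀ t : ℝ, (1 + t ^ 2) ≠ 0 := fun t => by positivity
  set q : ℝ → ℝ := fun t => (1 + 2 * t * g1 t - 2 * g t) / (1 + t ^ 2) with hq
  have hqc : Continuous q := by
    apply Continuous.div (by fun_prop) (by fun_prop) hpos
  have hd := ode_smooth g g1 q K hL I hIo hIc hqc hode
  have hqd : ∀ t ∈ I, HasDerivAt q 0 t := by
    intro t ht
    have h1 : HasDerivAt (fun t => 1 + 2 * t * g1 t - 2 * g t)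
        ((2 * g1 t + 2 * t * q t) - 2 * g1 t) t := by
      have h2 : HasDerivAt (fun t : ℝ => 2 * t) 2 t := by
        simpa using (hasDerivAt_id t).const_mul 2
      exact ((h2.mul (hd t ht)).const_add 1).sub ((hg t).const_mul 2)
    have h3 : HasDerivAt (fun t : ℝ => 1 + t ^ 2) (2 * t) t := by
      simpa using (hasDerivAt_pow 2 t).const_add 1
    have h4 := h1.div h3 (hpos t)
    refine h4.congr_deriv ?_
    have : q t * (1 + t ^ 2) = 1 + 2 * t * g1 t - 2 * g t := div_mul_cancel₀ _ (hpos t)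
    rw [← this]
    ring_nf
  obtain ⟨k, hk⟩ := hIo.exists_is_const_of_deriv_eq_zero hIc.isPreconnected
    (fun t ht => (hqd t ht).differentiableAt.differentiableWithinAt) (fun t ht => (hqd t ht).deriv)
  have hmd : ∀ t ∈ I, HasDerivAt (fun t => g1 t - k * t) 0 t := by
    intro t ht
    have := (hd t ht).sub ((hasDerivAt_id t).const_mul k)
    refine this.congr_deriv ?_
    rw [hk t ht]; simp
  obtain ⟨b, hb⟩ := hIo.exists_is_const_of_deriv_eq_zero hIc.isPreconnected
    (fun t ht => (hmd t ht).differentiableAt.differentiableWithinAt) (fun t ht => (hmd t ht).deriv)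
  refine ⟨k, b, fun t ht => ?_⟩
  have e1 : g1 t = k * t + b := by have := hb t ht; linarith
  have e2 : q t * (1 + t ^ 2) = 1 + 2 * t * g1 t - 2 * g t := div_mul_cancel₀ _ (hpos t)
  rw [hk t ht, e1] at e2
  exact ⟨e1, by linarith⟩

theorem quad_bdd (c k b C t0 : ℝ) (h : ∀ t, t0 ≤ t → |c + b * t + k * t ^ 2| ≤ C) :
    k = 0 ∧ b = 0 := by
  have h2 : ∀ s, 0 ≤ s → |c + b * (t0 + s) + k * (t0 + s) ^ 2| ≤ C := fun s hs => h _ (by linarith)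
  have key : ∀ p q r D : ℝ, (∀ s, 0 ≤ s → |p + q * s + r * s ^ 2| ≤ D) → r = 0 := by
    intro p q r D hD
    -- second difference
    have a0 := abs_le.1 (hD 0 le_rfl)
    by_contra hr
    have hr' : 0 < |r| := abs_pos.2 hr
    have hD0 : 0 ≤ D := (abs_nonneg _).trans (hD 0 le_rfl)
    set s := (4 * D + 1) / |r| + 1 with hs
    have hs1 : 1 ≤ s := by rw [hs]; have : 0 ≤ (4 * D + 1) / |r| := by positivity
                           linarith
    have a1 := abs_le.1 (hD s (by linarith))
    have a2 := abs_le.1 (hD (2 * s) (by linarith))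
    have hrs : 4 * D + 1 ≤ |r| * s := by
      rw [hs, mul_add, mul_div_cancel₀ _ hr'.ne']; linarith
    have : |r| * s ≤ |r| * s ^ 2 := by
      apply mul_le_mul_of_nonneg_left _ hr'.le; nlinarith
    rcases le_total 0 r with h | h
    · rw [abs_of_nonneg h] at *
      nlinarith
    · rw [abs_of_nonpos h] at *
      nlinarith
  have hk : k = 0 := by
    apply key (c + b * t0 + k * t0 ^ 2) (b + 2 * k * t0) k C
    intro s hs
    convert h2 s hs using 2; ring
  subst hk
  refine ⟨rfl, ?_⟩
  have hC : 0 ≤ C := (abs_nonneg _).trans (h2 0 le_rfl)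
  apply key 0 0 b (2 * C)
  intro s hs
  have a0 := abs_le.1 (h2 0 le_rfl)
  have a1 := abs_le.1 (h2 (s ^ 2) (by positivity))
  rw [abs_le]
  constructor <;> nlinarith

theorem ode_part (a : ℝ) (ha : 1 < a) (g g1 : ℝ → ℝ) (hg : ∀ t, HasDerivAt g (g1 t) t)
    (K : ℝ≥0) (hL : LipschitzWith K g1) (h0 : ∀ t, 0 ≤ g t) (h1 : ∀ t, g t ≤ a / 2)
    (hode : ∀ᵐ t, 0 < g t → g t < a / 2 →
      deriv g1 t = (1 + 2 * t * g1 t - 2 * g t) / (1 + t ^ 2)) :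
    (∀ t, g t = 0) ∨ (∀ t, g t = 1 / 2) ∨ ∀ t, g t = a / 2 := by
  have hgc : Continuous g := continuous_iff_continuousAt.2 fun t => (hg t).continuousAt
  have hgc1 : Continuous g1 := hL.continuous
  set V : Set ℝ := {t | 0 < g t ∧ g t < a / 2} with hV
  have hVo : IsOpen V := (isOpen_lt continuous_const hgc).inter (isOpen_lt hgc continuous_const)
  by_cases hne : ∃ t0, t0 ∈ V
  · right; left
    obtain ⟨t0, ht0⟩ := hne
    set I := connectedComponentIn V t0 with hI
    have hIo : IsOpen I := hVo.connectedComponentIn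
    have hIp : IsPreconnected I := isPreconnected_connectedComponentIn
    have hIc : I.OrdConnected := hIp.ordConnected
    have hIV : I ⊆ V := connectedComponentIn_subset V t0
    have htI : t0 ∈ I := mem_connectedComponentIn ht0
    obtain ⟨k, b, hkb⟩ := ode_quad g g1 hg K hL I hIo hIc (by
      filter_upwards [hode] with t ht hti using ht (hIV hti).1 (hIV hti).2)
    -- points of the closure outside I are outside V
    have hcl : ∀ p ∈ closure I, p ∈ V → p ∈ I := by
      intro p hp hpV
      have hpre : IsPreconnected (insert p I) :=
        hIp.subset_closure (subset_insert _ _) (insert_subset hp subset_closure)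
      exact hpre.subset_connectedComponentIn (mem_insert_of_mem _ htI)
        (insert_subset hpV hIV) (mem_insert _ _)
    have hclg1 : ∀ p ∈ closure I, g1 p = k * p + b := by
      intro p hp
      have hc : IsClosed {t | g1 t = k * t + b} := isClosed_eq hgc1 (by fun_prop)
      exact closure_minimal (fun t ht => (hkb t ht).1) hc hp
    have hend : ∀ p ∈ closure I, p ∉ I → k * p + b = 0 := by
      intro p hp hpI
      rw [← hclg1 p hp]
      have hpV : p ∉ V := fun h => hpI (hcl p hp h)
      rcases (h0 p).lt_or_eq with h | h
      · have h2 : g p = a / 2 := by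
          by_contra h3
          exact hpV ⟨h, lt_of_le_of_ne (h1 p) h3⟩
        have : IsLocalMax g p := Eventually.of_forall fun t => by
          show g t ≤ g p
          rw [h2]; exact h1 t
        exact this.hasDerivAt_eq_zero (hg p)
      · have : IsLocalMin g p := Eventually.of_forall fun t => by
          show g p ≤ g t
          rw [← h]; exact h0 t
        exact this.hasDerivAt_eq_zero (hg p)
    have hz : k = 0 ∧ b = 0 := by
      by_cases hA : BddAbove I
      · by_cases hB : BddBelow I
        · have hs : sSup I ∈ closure I := csSup_mem_closure ⟨_, htI⟩ hA
          have hi : sInf I ∈ closure I := csInf_mem_closure ⟨_, htI⟩ hB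
          have hs' : sSup I ∉ I := fun h => by
            obtain ⟨y, hy, hy2⟩ := (mem_nhdsGT_iff_exists_Ioo_subset.1
              (mem_nhdsWithin_of_mem_nhds (hIo.mem_nhds h)))
            have hm : (sSup I + y) / 2 ∈ I := hy2 ⟨by simp at hy; linarith, by simp at hy; linarith⟩
            have := le_csSup hA hm
            simp at hy; linarith
          have hi' : sInf I ∉ I := fun h => by
            obtain ⟨y, hy, hy2⟩ := (mem_nhdsLT_iff_exists_Ioo_subset.1
              (mem_nhdsWithin_of_mem_nhds (hIo.mem_nhds h)))
            have hm : (sInf I + y) / 2 ∈ I := hy2 ⟨by simp at hy; linarith, by simp at hy; linarith⟩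
            have := csInf_le hB hm
            simp at hy; linarith
          have e1 := hend _ hs hs'
          have e2 := hend _ hi hi'
          have l1 : t0 < sSup I := lt_of_le_of_ne (le_csSup hA htI) (fun h => hs' (h ▸ htI))
          have l2 : sInf I ≤ t0 := csInf_le hB htI
          have : k * (sSup I - sInf I) = 0 := by linarith
          rcases mul_eq_zero.1 this with h | h
          · subst h; exact ⟨rfl, by linarith⟩
          · linarith
        · have hsub : ∀ t, t ≤ t0 → t ∈ I := by
            intro t ht
            rw [not_bddBelow_iff] at hB
            obtain ⟨y, hy, hyt⟩ := hB t
            exact hIc.out hy htI ⟨hyt.le, ht⟩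
          have := quad_bdd ((1 - k) / 2) (k / 2) (-b) (a / 2) (-t0) (by
            intro t ht
            have hm := hkb (-t) (hsub _ (by linarith))
            have e : (1 - k) / 2 + -b * t + k / 2 * t ^ 2 = g (-t) := by rw [hm.2]; ring
            rw [e, abs_of_nonneg (h0 _)]; exact h1 _)
          exact ⟨by linarith [this.1], by linarith [this.2]⟩
      · have hsub : ∀ t, t0 ≤ t → t ∈ I := by
          intro t ht
          rw [not_bddAbove_iff] at hA
          obtain ⟨y, hy, hyt⟩ := hA t
          exact hIc.out htI hy ⟨ht, hyt.le⟩
        have := quad_bdd ((1 - k) / 2) (k / 2) b (a / 2) t0 (by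
          intro t ht
          have hm := hkb t (hsub _ ht)
          rw [← hm.2, abs_of_nonneg (h0 _)]; exact h1 _)
        exact ⟨by linarith [this.1], by linarith [this.2]⟩
    obtain ⟨rfl, rfl⟩ := hz
    have hhalf : ∀ p ∈ closure I, g p = 1 / 2 := by
      intro p hp
      have hc : IsClosed {t | g t = 1 / 2} := isClosed_eq hgc continuous_const
      exact closure_minimal (fun t ht => by have := (hkb t ht).2; simp at this ⊢; exact this) hc hp
    have hclosed : IsClosed I := by
      rw [← closure_subset_iff_isClosed]
      intro p hp
      refine hcl p hp ?_
      have := hhalf p hp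
      constructor <;> rw [this] <;> linarith
    have huniv : I = univ := IsClopen.eq_univ ⟨hclosed, hIo⟩ ⟨_, htI⟩
    intro t
    exact hhalf t (subset_closure (huniv ▸ mem_univ t))
  · have hor : ∀ t, g t = 0 ∨ g t = a / 2 := by
      intro t
      by_contra! h
      exact hne ⟨t, lt_of_le_of_ne (h0 t) h.1.symm, lt_of_le_of_ne (h1 t) h.2⟩
    by_cases hall : ∀ t, g t = 0
    · exact Or.inl hall
    · right; right
      push Not at hall
      obtain ⟨s, hs⟩ := hall
      have hs' := (hor s).resolve_left hs
      intro t
      rcases hor t with h | h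
      · exfalso
        have := mem_range_of_exists_le_of_exists_ge (c := a / 4) hgc ⟨t, by rw [h]; linarith⟩
          ⟨s, by rw [hs']; linarith⟩
        obtain ⟨r, hr⟩ := this
        rcases hor r with h | h <;> linarith
      · exact h

theorem pt_eq (p : E 2) (hp : 0 < p 0) : p = p 0 • (!₂[1, p 1 / p 0] : E 2) := by
  ext i
  fin_cases i
  · simp
  · simp; field_simp

theorem hom_form (u : E 2 → ℝ) (hhom : ∀ (x : E 2) (l : ℝ), 0 < l → u (l • x) = l ^ 2 * u x)
    (p : E 2) (hp : 0 < p 0) : u p = p 0 ^ 2 * u (!₂[1, p 1 / p 0] : E 2) := by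
  conv_lhs => rw [pt_eq p hp]
  exact hhom _ _ hp

theorem fderiv_of_line {F : E 2 → ℝ} {p v : E 2} {d : ℝ} (hF : DifferentiableAt ℝ F p)
    (h : HasDerivAt (fun s : ℝ => F (p + s • v)) d 0) : fderiv ℝ F p v = d :=
  (hF.hasFDerivAt.hasLineDerivAt v).unique h

theorem g_deriv (u : E 2 → ℝ) (hu : Differentiable ℝ u) (t : ℝ) :
    HasDerivAt (fun t : ℝ => u (!₂[1, t] : E 2))
      (fderiv ℝ u (!₂[1, t] : E 2) (EuclideanSpace.single 1 1)) t := by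
  have h1 : HasDerivAt (fun t : ℝ => (!₂[1, t] : E 2)) (EuclideanSpace.single 1 1) t := by
    have : (fun t : ℝ => (!₂[1, t] : E 2)) =
        fun t => (EuclideanSpace.single 0 1 : E 2) + t • (EuclideanSpace.single 1 1 : E 2) := by
      funext t
      ext i; fin_cases i <;> simp
    rw [this]
    simpa using ((hasDerivAt_id t).smul_const (EuclideanSpace.single 1 1 : E 2)).const_add
      (EuclideanSpace.single 0 1 : E 2)
  exact (hu _).hasFDerivAt.comp_hasDerivAt t h1

theorem d1 (u : E 2 → ℝ) (hu : Differentiable ℝ u)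
    (hhom : ∀ (x : E 2) (l : ℝ), 0 < l → u (l • x) = l ^ 2 * u x) (g g1 : ℝ → ℝ)
    (hgu : ∀ t, g t = u (!₂[1, t] : E 2))
    (hg : ∀ t, HasDerivAt g (g1 t) t)
    (p : E 2) (hp : 0 < p 0) :
    fderiv ℝ u p (EuclideanSpace.single 1 1) = p 0 * g1 (p 1 / p 0) := by
  apply fderiv_of_line (hu p)
  have : (fun s : ℝ => u (p + s • EuclideanSpace.single 1 1)) =
      fun s => p 0 ^ 2 * g ((p 1 + s) / p 0) := by
    funext s
    rw [hom_form u hhom _ (by simpa using hp), hgu]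
    simp
  rw [this]
  have h1 : HasDerivAt (fun s : ℝ => (p 1 + s) / p 0) (1 / p 0) 0 :=
    ((hasDerivAt_id (0 : ℝ)).const_add (p 1)).div_const (p 0)
  have h2 : HasDerivAt g (g1 (p 1 / p 0)) ((p 1 + 0) / p 0) := by simpa using hg (p 1 / p 0)
  refine ((h2.comp (0 : ℝ) h1).const_mul (p 0 ^ 2)).congr_deriv ?_
  field_simp

theorem inv_line (x y : ℝ) (hx : 0 < x) :
    HasDerivAt (fun s : ℝ => y / (x + s)) (-(y / x ^ 2)) 0 := by
  have h1 := (hasDerivAt_const (0 : ℝ) y).div ((hasDerivAt_id (0 : ℝ)).const_add x)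
    (by simpa using hx.ne')
  refine h1.congr_deriv ?_
  simp [neg_div]

theorem d0 (u : E 2 → ℝ) (hu : Differentiable ℝ u)
    (hhom : ∀ (x : E 2) (l : ℝ), 0 < l → u (l • x) = l ^ 2 * u x) (g g1 : ℝ → ℝ)
    (hgu : ∀ t, g t = u (!₂[1, t] : E 2))
    (hg : ∀ t, HasDerivAt g (g1 t) t)
    (p : E 2) (hp : 0 < p 0) :
    fderiv ℝ u p (EuclideanSpace.single 0 1) = 2 * p 0 * g (p 1 / p 0) - p 1 * g1 (p 1 / p 0) := by
  apply fderiv_of_line (hu p)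
  have : (fun s : ℝ => u (p + s • EuclideanSpace.single 0 1)) =ᶠ[nhds 0]
      fun s => (p 0 + s) ^ 2 * g (p 1 / (p 0 + s)) := by
    filter_upwards [lt_mem_nhds (show -p 0 < 0 by linarith)] with s hs
    rw [hom_form u hhom _ (by simp; linarith), hgu]
    simp
  refine HasDerivAt.congr_of_eventuallyEq ?_ this
  have h1 := inv_line (p 0) (p 1) hp
  have h2 : HasDerivAt g (g1 (p 1 / p 0)) (p 1 / (p 0 + 0)) := by simpa using hg (p 1 / p 0)
  have h3 : HasDerivAt (fun s : ℝ => (p 0 + s) ^ 2) (2 * p 0) 0 := by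
    refine (((hasDerivAt_id (0 : ℝ)).const_add (p 0)).pow 2).congr_deriv ?_
    simp
  refine (h3.mul (h2.comp (0 : ℝ) h1)).congr_deriv ?_
  simp
  field_simp
  ring

theorem lap_eq (u : E 2 → ℝ) (hu : Differentiable ℝ u)
    (hhom : ∀ (x : E 2) (l : ℝ), 0 < l → u (l • x) = l ^ 2 * u x) (g g1 : ℝ → ℝ)
    (hgu : ∀ t, g t = u (!₂[1, t] : E 2))
    (hg : ∀ t, HasDerivAt g (g1 t) t)
    (p : E 2) (hp : 0 < p 0) (t : ℝ) (ht : p 1 = t * p 0) (hd : DifferentiableAt ℝ g1 t) :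
    lap u p = (1 + t ^ 2) * deriv g1 t - 2 * t * g1 t + 2 * g t := by
  have htt : p 1 / p 0 = t := by rw [ht]; field_simp
  have hnh : ∀ᶠ q : E 2 in nhds p, 0 < q 0 :=
    (isOpen_lt continuous_const (by fun_prop : Continuous fun q : E 2 => q 0)).mem_nhds hp
  have E1 : (fun y => fderiv ℝ u y (EuclideanSpace.single 1 1)) =ᶠ[nhds p]
      fun q => q 0 * g1 (q 1 / q 0) := by
    filter_upwards [hnh] with q hq using d1 u hu hhom g g1 hgu hg q hq
  have E0 : (fun y => fderiv ℝ u y (EuclideanSpace.single 0 1)) =ᶠ[nhds p]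
      fun q => 2 * q 0 * g (q 1 / q 0) - q 1 * g1 (q 1 / q 0) := by
    filter_upwards [hnh] with q hq using d0 u hu hhom g g1 hgu hg q hq
  have c0 : DifferentiableAt ℝ (fun q : E 2 => q 0) p := by fun_prop
  have c1 : DifferentiableAt ℝ (fun q : E 2 => q 1) p := by fun_prop
  have cq : DifferentiableAt ℝ (fun q : E 2 => q 1 / q 0) p := by
    simp only [div_eq_mul_inv]
    exact c1.mul (c0.fun_inv hp.ne')
  have cg1 : DifferentiableAt ℝ (fun q : E 2 => g1 (q 1 / q 0)) p :=
    DifferentiableAt.comp (g := g1) p (by rw [htt]; exact hd) cq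
  have cg : DifferentiableAt ℝ (fun q : E 2 => g (q 1 / q 0)) p :=
    DifferentiableAt.comp (g := g) p (hg _).differentiableAt cq
  have D1 : DifferentiableAt ℝ (fun q : E 2 => q 0 * g1 (q 1 / q 0)) p := c0.mul cg1
  have D0 : DifferentiableAt ℝ (fun q : E 2 => 2 * q 0 * g (q 1 / q 0) - q 1 * g1 (q 1 / q 0)) p :=
    ((c0.const_mul 2).mul cg).sub (c1.mul cg1)
  have hpos := hp.ne'
  have R1 : fderiv ℝ (fun q : E 2 => q 0 * g1 (q 1 / q 0)) p (EuclideanSpace.single 1 1)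
      = deriv g1 t := by
    apply fderiv_of_line D1
    have h1 : HasDerivAt (fun s : ℝ => (p 1 + s) / p 0) (1 / p 0) 0 :=
      ((hasDerivAt_id (0 : ℝ)).const_add (p 1)).div_const (p 0)
    have h2 : HasDerivAt g1 (deriv g1 t) ((p 1 + 0) / p 0) := by
      rw [add_zero, htt]; exact hd.hasDerivAt
    have h3 := ((h2.comp (0 : ℝ) h1).const_mul (p 0))
    refine (h3.congr_deriv ?_).congr_of_eventuallyEq (Eventually.of_forall fun s => ?_)
    · field_simp
    · simp
  have R0 : fderiv ℝ (fun q : E 2 => 2 * q 0 * g (q 1 / q 0) - q 1 * g1 (q 1 / q 0)) p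
      (EuclideanSpace.single 0 1) = 2 * g t - 2 * t * g1 t + t ^ 2 * deriv g1 t := by
    apply fderiv_of_line D0
    have h1 := inv_line (p 0) (p 1) hp
    have h2 : HasDerivAt g1 (deriv g1 t) (p 1 / (p 0 + 0)) := by
      rw [add_zero, htt]; exact hd.hasDerivAt
    have h2' : HasDerivAt g (g1 t) (p 1 / (p 0 + 0)) := by
      rw [add_zero, htt]; exact hg t
    have h4 : HasDerivAt (fun s : ℝ => 2 * (p 0 + s)) 2 0 := by
      simpa using ((hasDerivAt_id (0 : ℝ)).const_add (p 0)).const_mul 2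
    have h3 := (h4.mul (h2'.comp (0 : ℝ) h1)).sub ((h2.comp (0 : ℝ) h1).const_mul (p 1))
    refine (h3.congr_deriv ?_).congr_of_eventuallyEq (Eventually.of_forall fun s => ?_)
    · simp only [Function.comp, add_zero, htt]
      rw [ht]; field_simp; ring
    · simp
  unfold lap
  rw [Fin.sum_univ_two, E1.fderiv_eq, E0.fderiv_eq, R1, R0]
  ring

theorem slice_ae (P : E 2 → Prop) (h : ∀ᵐ x : E 2, P x) :
    ∃ c : ℝ, 0 < c ∧ ∀ᵐ t : ℝ, P (!₂[c, c * t] : E 2) := by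
  have h1 : ∀ᵐ z : ℝ × ℝ, P (!₂[z.1, z.2] : E 2) := by
    have m1 : MeasurePreserving (MeasurableEquiv.finTwoArrow (α := ℝ)).symm volume volume :=
      (volume_preserving_finTwoArrow ℝ).symm _
    have m2 : MeasurePreserving (@WithLp.toLp 2 (Fin 2 → ℝ)) volume volume :=
      PiLp.volume_preserving_toLp (Fin 2)
    exact (m2.comp m1).quasiMeasurePreserving.ae h
  have h2 : ∀ᵐ x : ℝ, ∀ᵐ y : ℝ, P (!₂[x, y] : E 2) := Measure.ae_ae_of_ae_prod h1
  obtain ⟨c, hc, hc0⟩ : ∃ c, (∀ᵐ y : ℝ, P (!₂[c, y] : E 2)) ∧ 0 < c := by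
    obtain ⟨c, hc, hc0⟩ := (Measure.dense_of_ae h2).inter_open_nonempty (Ioi 0) isOpen_Ioi ⟨1, by simp⟩
    exact ⟨c, hc0, hc⟩
  refine ⟨c, hc0, ?_⟩
  rw [ae_iff] at hc ⊢
  have := Measure.addHaar_preimage_smul (volume : Measure ℝ) hc0.ne' {y | ¬ P (!₂[c, y] : E 2)}
  rw [hc, mul_zero] at this
  exact this

/-- **Classification of homogeneous two-dimensional global solutions.** In `ℝ²`, if
`u ∈ P_∞(M)` with `ψ(x) = (a/2)(x₁⁺)²`, `a > 1`, satisfies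
`Δu = χ_{{0<u<ψ}} + a·χ_{{0<u=ψ}}` and `0 ≤ u ≤ ψ` a.e., and `u` is homogeneous of degree
two, then `u = (1/2)(x₁⁺)²` or `u = (a/2)(x₁⁺)²`. -/
theorem classification_homogeneous (M a : ℝ) (u ψ : E 2 → ℝ)
    (hpsi : ψ = fun x => a / 2 * max (x 0) 0 ^ 2)
    (hP : Pinf 2 M a u ψ)
    (heq : ∀ᵐ x : E 2,
      lap u x = ({y | 0 < u y ∧ u y < ψ y}).indicator (fun _ => (1 : ℝ)) x
        + ({y | 0 < u y ∧ u y = ψ y}).indicator (fun _ => a) x ∧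
      0 ≤ u x ∧ u x ≤ ψ x)
    (hhom : ∀ (x : E 2) (l : ℝ), 0 < l → u (l • x) = l ^ 2 * u x) :
    (∀ x, u x = 1 / 2 * max (x 0) 0 ^ 2) ∨ (∀ x, u x = a / 2 * max (x 0) 0 ^ 2) := by
  have ha := hP.ha
  have hu : Differentiable ℝ u := hP.u_c1.differentiable (by norm_num)
  have hunn : ∀ x, 0 ≤ u x := by
    have hd : Dense {x | 0 ≤ u x} := Measure.dense_of_ae (heq.mono fun x hx => hx.2.1)
    have hc : IsClosed {x | 0 ≤ u x} := isClosed_le continuous_const hu.continuous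
    intro x
    have := hc.closure_eq ▸ hd x
    exact this
  have hle : ∀ x, u x ≤ a / 2 * max (x 0) 0 ^ 2 := fun x => by
    have := hP.u_le x
    rwa [hpsi] at this
  have hneg : ∀ x : E 2, x 0 ≤ 0 → u x = 0 := fun x hx => by
    have := hle x
    rw [max_eq_right hx] at this
    simp at this
    exact le_antisymm this (hunn x)
  set g : ℝ → ℝ := fun t => u (!₂[1, t] : E 2) with hgdef
  set g1 : ℝ → ℝ := fun t => fderiv ℝ u (!₂[1, t] : E 2) (EuclideanSpace.single 1 1) with hg1def
  have hgu : ∀ t, g t = u (!₂[1, t] : E 2) := fun t => rfl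
  have hg : ∀ t, HasDerivAt g (g1 t) t := fun t => g_deriv u hu t
  have hL : LipschitzWith (Real.toNNReal M) g1 := by
    refine LipschitzWith.of_dist_le_mul fun s t => ?_
    have h1 := hP.u_c11.dist_le_mul (!₂[1, s] : E 2) (!₂[1, t] : E 2)
    have h2 : dist (!₂[1, s] : E 2) (!₂[1, t] : E 2) = dist s t := by
      rw [EuclideanSpace.dist_eq]
      simp [Real.sqrt_sq dist_nonneg]
    rw [h2] at h1
    refine le_trans ?_ h1
    rw [dist_eq_norm, dist_eq_norm]
    have h3 := (fderiv ℝ u (!₂[1, s] : E 2) - fderiv ℝ u (!₂[1, t] : E 2)).le_opNorm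
      (EuclideanSpace.single 1 1)
    simpa using h3
  have hform : ∀ p : E 2, 0 < p 0 → u p = p 0 ^ 2 * g (p 1 / p 0) := fun p hp =>
    hom_form u hhom p hp
  have hg0 : ∀ t, 0 ≤ g t := fun t => hunn _
  have hg2 : ∀ t, g t ≤ a / 2 := fun t => by
    have := hle (!₂[1, t] : E 2)
    simpa using this
  have hode : ∀ᵐ t, 0 < g t → g t < a / 2 →
      deriv g1 t = (1 + 2 * t * g1 t - 2 * g t) / (1 + t ^ 2) := by
    obtain ⟨c, hc, hs⟩ := slice_ae _ heq
    filter_upwards [hs, hL.ae_differentiableAt_real] with t ht hdt hp1 hp2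
    have hpc : 0 < (!₂[c, c * t] : E 2) 0 := by simpa using hc
    have hl := lap_eq u hu hhom g g1 hgu hg (!₂[c, c * t] : E 2) hpc t (by simp [mul_comm]) hdt
    have hup : u (!₂[c, c * t] : E 2) = c ^ 2 * g t := by
      rw [hform _ hpc]
      have : c * t / c = t := by field_simp
      simp [this]
    have hpp : ψ (!₂[c, c * t] : E 2) = c ^ 2 * (a / 2) := by
      rw [hpsi]; simp [max_eq_left hc.le]; ring
    have hc2 : 0 < c ^ 2 := by positivity
    have m1 : (!₂[c, c * t] : E 2) ∈ {y | 0 < u y ∧ u y < ψ y} := by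
      refine ⟨?_, ?_⟩
      · rw [hup]; positivity
      · rw [hup, hpp]; exact mul_lt_mul_of_pos_left hp2 hc2
    have m2 : (!₂[c, c * t] : E 2) ∉ {y | 0 < u y ∧ u y = ψ y} := fun h => m1.2.ne h.2
    have h1 := ht.1
    rw [indicator_of_mem m1, indicator_of_notMem m2, hl] at h1
    rw [eq_div_iff (by positivity)]
    linarith
  have hfin : ∀ C : ℝ, (∀ t, g t = C) → ∀ x, u x = C * max (x 0) 0 ^ 2 := by
    intro C hC x
    rcases le_or_gt (x 0) 0 with h | h
    · rw [hneg x h, max_eq_right h]; simp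
    · rw [hform x h, hC, max_eq_left h.le]; ring
  rcases ode_part a ha g g1 hg _ hL hg0 hg2 hode with h | h | h
  · exfalso
    have hz : u = fun _ => 0 := by
      funext x; rw [hfin 0 h x]; simp
    have : Lam univ u = univ := by
      ext x
      simp [Lam, hz, gradient]
    have hzm := hP.zero_mem
    rw [this, frontier_univ] at hzm
    exact hzm
  · exact Or.inl (hfin _ h)
  · exact Or.inr (hfin _ h)
end
end
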